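/- arXiv:2605.31225 — 2 statements merged into one kernel-verified Lean document; each statement's English description precedes it below -/
import Mathlib

section
/- Let H* be a finite simple graph with no K_{2,3} minor and let α* be a proper 5-coloring of H*. Then there exists a proper coloring β* of H* using only 4 of the 5 colors such that there is a transformation from α* to β* (through proper 5-colorings) recoloring each vertex at most 692 times. -/
open SimpleGraph

/-- A proper coloring of `G` with `ℓ` colors: adjacent vertices get distinct colors. -/
def IsProperColoring {V : Type} (G : SimpleGraph V) {ℓ : ℕ} (c : V → Fin ℓ) : Prop :=
  ∀ ⦃u v : V⦄, G.Adj u v → c u ≠ c v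

/-- `c` is a transformation sequence from `α` to `β`: a sequence of proper colorings
starting at `α`, ending at `β`, in which consecutive colorings differ on exactly one vertex. -/
def IsTransformSeq {V : Type} (G : SimpleGraph V) {ℓ m : ℕ}
    (c : Fin (m + 1) → V → Fin ℓ) (α β : V → Fin ℓ) : Prop :=
  c 0 = α ∧ c (Fin.last m) = β ∧ (∀ i, IsProperColoring G (c i)) ∧
    ∀ i : Fin m, ∃! v : V, c i.castSucc v ≠ c i.succ v

/-- The number of steps of the sequence `c` at which the vertex `v` is recolored. -/
def RecolorCount {V : Type} {ℓ m : ℕ} (c : Fin (m + 1) → V → Fin ℓ) (v : V) : ℕ :=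
  (Finset.univ.filter fun i : Fin m => c i.castSucc v ≠ c i.succ v).card

/-- `H` is a minor of `G`: there are pairwise disjoint nonempty branch sets in `G`, each
inducing a connected subgraph, with an edge of `G` between the branch sets of any two
vertices adjacent in `H`. -/
def IsMinor {W V : Type} (H : SimpleGraph W) (G : SimpleGraph V) : Prop :=
  ∃ B : W → Set V,
    (∀ h, (B h).Nonempty) ∧
    (Pairwise fun h h' => Disjoint (B h) (B h')) ∧
    (∀ h, (G.induce (B h)).Connected) ∧
    ∀ ⦃h h'⦄, H.Adj h h' → ∃ u ∈ B h, ∃ v ∈ B h', G.Adj u v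

namespace Recoloring

open scoped Classical

section Moves

variable {V : Type} {G : SimpleGraph V} {U W N : Set V}

/-- The coloring obtained from `c` by performing the moves of the list in order; the move
`(v, k)` gives color `k` to the vertex `v`. -/
noncomputable def run (c : V → Fin 5) : List (V × Fin 5) → V → Fin 5
  | [] => c
  | m :: l => run (Function.update c m.1 m.2) l

/-- The moves only concern vertices of `W`, and none of them gives to a vertex the current color
of one of its neighbors in `W`. -/
def Valid (G : SimpleGraph V) (W : Set V) (c : V → Fin 5) : List (V × Fin 5) → Prop
  | [] => True
  | m :: l => m.1 ∈ W ∧ (∀ w ∈ W, G.Adj m.1 w → c w ≠ m.2) ∧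
      Valid G W (Function.update c m.1 m.2) l

/-- The number of moves of `l` that concern `v`. -/
noncomputable def cnt (v : V) (l : List (V × Fin 5)) : ℕ := l.countP fun m => m.1 = v

@[simp] lemma run_nil (c : V → Fin 5) : run c [] = c := rfl

@[simp] lemma run_cons (c : V → Fin 5) (m : V × Fin 5) (l) :
    run c (m :: l) = run (Function.update c m.1 m.2) l := rfl

@[simp] lemma valid_nil (c : V → Fin 5) : Valid G W c [] := trivial

@[simp] lemma valid_cons (c : V → Fin 5) (m : V × Fin 5) (l) :
    Valid G W c (m :: l) ↔ m.1 ∈ W ∧ (∀ w ∈ W, G.Adj m.1 w → c w ≠ m.2) ∧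
      Valid G W (Function.update c m.1 m.2) l := Iff.rfl

@[simp] lemma cnt_nil (v : V) : cnt v [] = 0 := rfl

lemma cnt_cons (v : V) (m : V × Fin 5) (l) :
    cnt v (m :: l) = cnt v l + if m.1 = v then 1 else 0 := by
  simp [cnt, List.countP_cons]

@[simp] lemma cnt_append (v : V) (l l' : List (V × Fin 5)) :
    cnt v (l ++ l') = cnt v l + cnt v l' := by
  simp [cnt]

lemma run_append (c : V → Fin 5) (l l') : run c (l ++ l') = run (run c l) l' := by
  induction l generalizing c with
  | nil => rfl
  | cons m l ih => simp [ih]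

lemma valid_append (c : V → Fin 5) (l l') :
    Valid G W c (l ++ l') ↔ Valid G W c l ∧ Valid G W (run c l) l' := by
  induction l generalizing c with
  | nil => simp
  | cons m l ih => simp [ih, and_assoc]

lemma Valid.mem {c : V → Fin 5} {l} (h : Valid G W c l) : ∀ m ∈ l, m.1 ∈ W := by
  induction l generalizing c with
  | nil => simp
  | cons m l ih =>
    intro m' hm'
    rcases List.mem_cons.1 hm' with rfl | hm'
    · exact h.1
    · exact ih h.2.2 m' hm'

lemma Valid.congr {c c' : V → Fin 5} {l} (h : Valid G W c l) (hc : ∀ v ∈ W, c v = c' v) :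
    Valid G W c' l := by
  induction l generalizing c c' with
  | nil => trivial
  | cons m l ih =>
    refine ⟨h.1, fun w hw a => hc w hw ▸ h.2.1 w hw a, ih h.2.2 fun v hv => ?_⟩
    by_cases hvm : v = m.1
    · subst hvm; simp
    · simp [hvm, hc v hv]

lemma run_eq_of_filter (c c' : V → Fin 5) (l) (hc : ∀ v ∈ U, c v = c' v) :
    ∀ v ∈ U, run c l v = run c' (l.filter fun m => m.1 ∈ U) v := by
  induction l generalizing c c' with
  | nil => simpa using hc
  | cons m l ih =>
    by_cases hm : m.1 ∈ U
    · simp only [run_cons, List.filter_cons, hm, decide_true, if_true]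
      refine ih _ _ fun v hv => ?_
      by_cases hvm : v = m.1
      · subst hvm; simp
      · simp [hvm, hc v hv]
    · simp only [run_cons, List.filter_cons, hm, decide_false]
      refine ih _ _ fun v hv => ?_
      have : v ≠ m.1 := fun e => hm (e ▸ hv)
      simp [this, hc v hv]

lemma run_eq_of_forall_ne (c : V → Fin 5) (l) (v : V) (h : ∀ m ∈ l, m.1 ≠ v) :
    run c l v = c v := by
  induction l generalizing c with
  | nil => rfl
  | cons m l ih =>
    rw [run_cons, ih _ fun m' hm' => h m' (List.mem_cons_of_mem _ hm')]
    simp [(h m List.mem_cons_self).symm]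

lemma cnt_filter {v : V} (hv : v ∈ U) (l : List (V × Fin 5)) :
    cnt v (l.filter fun m => m.1 ∈ U) = cnt v l := by
  induction l with
  | nil => rfl
  | cons m l ih =>
    by_cases hm : m.1 ∈ U
    · simp [hm, cnt_cons, ih]
    · have : m.1 ≠ v := fun e => hm (e ▸ hv)
      simp [hm, cnt_cons, ih, this]

lemma cnt_eq_zero {v : V} {l : List (V × Fin 5)} : cnt v l = 0 ↔ ∀ m ∈ l, m.1 ≠ v := by
  simp [cnt, List.countP_eq_zero]

lemma run_induction_color (c : V → Fin 5) (l) (v : V) (S : Fin 5 → Prop) (h0 : S (c v))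
    (h : ∀ m ∈ l, m.1 = v → S m.2) : S (run c l v) := by
  induction l generalizing c with
  | nil => exact h0
  | cons m l ih =>
    refine ih _ ?_ fun m' hm' => h m' (List.mem_cons_of_mem _ hm')
    by_cases hv : m.1 = v
    · subst hv; simpa using h m List.mem_cons_self rfl
    · simpa [Ne.symm hv] using h0

/-- The list `l'` of moves on `U ∪ N` extends the list `l` of moves on `U`; its new moves satisfy
`T`, and each vertex `v` of `N` is moved at most `κ v` times. -/
structure Ext (G : SimpleGraph V) (U N : Set V) (T : V × Fin 5 → Prop) (κ : V → ℕ)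
    (c : V → Fin 5) (l l' : List (V × Fin 5)) : Prop where
  valid : Valid G (U ∪ N) c l'
  filter_eq : (l'.filter fun m => m.1 ∈ U) = l
  tgt : ∀ m ∈ l', m.1 ∉ U → T m
  cnt_le : ∀ v ∈ N, cnt v l' ≤ κ v

variable {T T' : V × Fin 5 → Prop} {κ κ' : V → ℕ} {c : V → Fin 5}
  {l l' l₁ l₁' l₂ l₂' : List (V × Fin 5)}

lemma Ext.run_eq (h : Ext G U N T κ c l l') : ∀ v ∈ U, run c l' v = run c l v := by
  intro v hv
  rw [run_eq_of_filter c c l' (fun _ _ => rfl) v hv, h.filter_eq]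

lemma Ext.mono (h : Ext G U N T κ c l l') (hT : ∀ m, m.1 ∉ U → T m → T' m)
    (hκ : ∀ v ∈ N, κ v ≤ κ' v) : Ext G U N T' κ' c l l' :=
  ⟨h.valid, h.filter_eq, fun m hm hU => hT m hU (h.tgt m hm hU),
    fun v hv => (h.cnt_le v hv).trans (hκ v hv)⟩

lemma Ext.nil : Ext G U N T (fun _ => 0) c [] [] :=
  ⟨trivial, rfl, by simp, by simp⟩

lemma Ext.append (h₁ : Ext G U N T κ c l₁ l₁') (h₂ : Ext G U N T κ' (run c l₁') l₂ l₂') :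
    Ext G U N T (fun v => κ v + κ' v) c (l₁ ++ l₂) (l₁' ++ l₂') where
  valid := (valid_append ..).2 ⟨h₁.valid, h₂.valid⟩
  filter_eq := by rw [List.filter_append, h₁.filter_eq, h₂.filter_eq]
  tgt m hm hU := (List.mem_append.1 hm).elim (fun h => h₁.tgt m h hU) fun h => h₂.tgt m h hU
  cnt_le v hv := by
    rw [cnt_append]; exact Nat.add_le_add (h₁.cnt_le v hv) (h₂.cnt_le v hv)

lemma Ext.valid_of_append (h₁ : Ext G U N T κ c l₁ l₁') (h : Valid G U c (l₁ ++ l₂)) :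
    Valid G U (run c l₁') l₂ :=
  ((valid_append ..).1 h).2.congr fun v hv => (h₁.run_eq v hv).symm

/-- A move of `U` none of whose neighbors in `N` obstructs it. -/
lemma Ext.single (hUN : Disjoint U N) {m : V × Fin 5} (hm : m.1 ∈ U)
    (h₁ : ∀ w ∈ U, G.Adj m.1 w → c w ≠ m.2) (h₂ : ∀ w ∈ N, G.Adj m.1 w → c w ≠ m.2) :
    Ext G U N T (fun _ => 0) c [m] [m] where
  valid := ⟨Or.inl hm, fun w hw => hw.elim (h₁ w) (h₂ w), trivial⟩
  filter_eq := by simp [hm]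
  tgt m' hm' hU := by
    rw [List.mem_singleton.1 hm'] at hU; exact absurd hm hU
  cnt_le v hv := by
    have : m.1 ≠ v := fun e => hUN.le_bot ⟨hm, e ▸ hv⟩
    simp [cnt_cons, this]

/-- Extending a list of moves by inserting a response before every move. -/
lemma exists_ext_of_response (hUN : Disjoint U N) (Inv : (V → Fin 5) → Prop)
    (OK : V × Fin 5 → Prop) (D : V → V × Fin 5 → Prop)
    (step : ∀ c m, Inv c → m.1 ∈ U → OK m → (∀ w ∈ U, G.Adj m.1 w → c w ≠ m.2) →
      ∃ r, Ext G U N T (fun v => if D v m then 1 else 0) c [] r ∧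
        (∀ w ∈ N, G.Adj m.1 w → run c r w ≠ m.2) ∧
        Inv (Function.update (run c r) m.1 m.2))
    (l : List (V × Fin 5)) (c : V → Fin 5) (h0 : Inv c) (hl : Valid G U c l)
    (hOK : ∀ m ∈ l, OK m) :
    ∃ l', Ext G U N T (fun v => l.countP fun m => D v m) c l l' ∧ Inv (run c l') := by
  induction l generalizing c with
  | nil => exact ⟨[], by simpa using Ext.nil, h0⟩
  | cons m l ih =>
    obtain ⟨r, hr, hr1, hr2⟩ := step c m h0 hl.1 (hOK m List.mem_cons_self) hl.2.1
    have hU : ∀ v ∈ U, run c r v = c v := fun v hv => hr.run_eq v hv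
    have hs : Ext G U N T (fun _ => 0) (run c r) [m] [m] :=
      Ext.single hUN hl.1 (fun w hw a => by rw [hU w hw]; exact hl.2.1 w hw a) hr1
    obtain ⟨l', hl', hInv⟩ := ih (Function.update (run c r) m.1 m.2) hr2
      (hl.2.2.congr fun v hv => by
        by_cases hvm : v = m.1
        · subst hvm; simp
        · simp [hvm, hU v hv])
      fun m' hm' => hOK m' (List.mem_cons_of_mem _ hm')
    have h2 := (hr.append hs).append (l₂ := l) (l₂' := l') (κ' := fun v => l.countP fun m => D v m)
      (by simpa [run_append] using hl')
    refine ⟨r ++ [m] ++ l', h2.mono (fun _ _ h => h) fun v _ => ?_, by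
      simpa [run_append] using hInv⟩
    simp [List.countP_cons, Nat.add_comm]

/-- Recoloring all vertices of an independent subset of `N`. -/
lemma exists_ext_recolor [Finite V] (hUN : Disjoint U N) {M : Set V} (hM : M ⊆ N)
    (hind : ∀ v ∈ M, ∀ w ∈ M, ¬ G.Adj v w) (f : V → Fin 5) (c : V → Fin 5)
    (hf : ∀ v ∈ M, ∀ w ∈ U ∪ N, G.Adj v w → c w ≠ f v) :
    ∃ r, Ext G U N (fun m => m.1 ∈ M ∧ m.2 = f m.1) (fun v => if v ∈ M then 1 else 0) c [] r ∧
      run c r = fun v => if v ∈ M then f v else c v := by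
  have key : ∀ (L : List V) (c : V → Fin 5), L.Nodup → (∀ v ∈ L, v ∈ M) →
      (∀ v ∈ L, ∀ w ∈ U ∪ N, G.Adj v w → c w ≠ f v) →
      Valid G (U ∪ N) c (L.map fun v => (v, f v)) ∧
      run c (L.map fun v => (v, f v)) = fun v => if v ∈ L then f v else c v := by
    intro L
    induction L with
    | nil => intro c _ _ _; simp
    | cons v L ih =>
      intro c hnd hLM hL
      rw [List.nodup_cons] at hnd
      obtain ⟨h1, h2⟩ := ih (Function.update c v (f v)) hnd.2
        (fun u hu => hLM u (List.mem_cons_of_mem _ hu)) (by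
          intro u hu w hw a
          have : w ≠ v := by
            rintro rfl
            exact hind u (hLM u (List.mem_cons_of_mem _ hu)) w (hLM w List.mem_cons_self) a
          rw [Function.update_of_ne this]
          exact hL u (List.mem_cons_of_mem _ hu) w hw a)
      refine ⟨⟨Or.inr (hM (hLM v List.mem_cons_self)), hL v List.mem_cons_self, h1⟩, ?_⟩
      rw [List.map_cons, run_cons, h2]
      funext u
      by_cases huL : u ∈ L
      · simp [huL]
      · by_cases huv : u = v
        · subst huv; simp [hnd.1]
        · simp [huL, huv]
  have hfin := Set.toFinite M
  obtain ⟨h1, h2⟩ := key hfin.toFinset.toList c (Finset.nodup_toList _) (by simp)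
    (by simpa using hf)
  refine ⟨_, ⟨h1, ?_, ?_, ?_⟩, by simpa using h2⟩
  · simp only [List.filter_eq_nil_iff, List.mem_map, Finset.mem_toList, Set.Finite.mem_toFinset]
    rintro m ⟨v, hv, rfl⟩
    simpa using fun hU => hUN.le_bot ⟨hU, hM hv⟩
  · simp only [List.mem_map, Finset.mem_toList, Set.Finite.mem_toFinset]
    rintro m ⟨v, hv, rfl⟩ _
    exact ⟨hv, rfl⟩
  · intro v _
    rw [cnt, List.countP_map]
    have : (hfin.toFinset.toList.countP ((fun m : V × Fin 5 => decide (m.1 = v)) ∘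
        fun v => (v, f v))) = hfin.toFinset.toList.count v := by
      simp only [List.count]; congr 1
    rw [this, List.Nodup.count (Finset.nodup_toList _)]
    simp

end Moves

section TransformSeq

variable {V : Type} {G : SimpleGraph V}

lemma isProperColoring_update {c : V → Fin 5} (hc : IsProperColoring G c) (v : V) (k : Fin 5)
    (h : ∀ w, G.Adj v w → c w ≠ k) : IsProperColoring G (Function.update c v k) := by
  intro x y hxy
  by_cases hx : x = v
  · subst hx
    have hy : y ≠ x := hxy.ne'
    simpa [hy] using (h y hxy).symm
  · by_cases hy : y = v
    · subst hy
      simpa [hx] using h x hxy.symm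
    · simpa [hx, hy] using hc hxy

lemma exists_isTransformSeq (c : V → Fin 5) (hc : IsProperColoring G c)
    (l : List (V × Fin 5)) (hl : Valid G Set.univ c l) :
    IsProperColoring G (run c l) ∧ ∃ (m : ℕ) (s : Fin (m + 1) → V → Fin 5),
      IsTransformSeq G s c (run c l) ∧ ∀ v, RecolorCount s v ≤ cnt v l := by
  induction l generalizing c with
  | nil =>
    exact ⟨hc, 0, fun _ => c, ⟨rfl, rfl, fun _ => hc, fun i => i.elim0⟩, fun v => by
      simp [RecolorCount]⟩
  | cons m l ih =>
    obtain ⟨h1, n, s, hs, hcnt⟩ := ih (Function.update c m.1 m.2)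
      (isProperColoring_update hc _ _ fun w => hl.2.1 w trivial) hl.2.2
    refine ⟨h1, ?_⟩
    by_cases hm : c m.1 = m.2
    · rw [← hm, Function.update_eq_self] at hs
      refine ⟨n, s, by rw [run_cons, ← hm, Function.update_eq_self]; exact hs, fun v => ?_⟩
      exact (hcnt v).trans (by rw [cnt_cons]; omega)
    · obtain ⟨hs0, hs1, hs2, hs3⟩ := hs
      have h0 : ∀ v, c v ≠ s 0 v ↔ m.1 = v := by
        intro v
        rw [hs0]
        by_cases hv : v = m.1
        · subst hv; simpa using hm
        · simp [hv, Ne.symm hv]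
      refine ⟨n + 1, Fin.cons c s, ⟨rfl, ?_, ?_, ?_⟩, fun v => ?_⟩
      · rw [← Fin.succ_last, Fin.cons_succ, hs1, run_cons]
      · intro i
        refine Fin.cases hc (fun j => ?_) i
        exact hs2 j
      · intro i
        refine Fin.cases ?_ (fun j => ?_) i
        · exact ⟨m.1, (h0 _).2 rfl, fun v hv => ((h0 v).1 hv).symm⟩
        · simpa using hs3 j
      · unfold RecolorCount at hcnt ⊢
        have := hcnt v
        rw [Fin.card_filter_univ_succ, cnt_cons]
        simp only [← Fin.succ_castSucc, Fin.cons_succ, Fin.castSucc_zero, Fin.cons_zero]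
        by_cases hv : m.1 = v
        · rw [if_pos ((h0 v).2 hv), if_pos hv]; omega
        · rw [if_neg fun h => hv ((h0 v).1 h), if_neg hv]; omega

end TransformSeq

section Bag

variable {V : Type} {G : SimpleGraph V} {U A B : Set V} {z p q : V} {par : V → V}
  {c : V → Fin 5} {l : List (V × Fin 5)}

lemma exists_color_ne₄ (a b c d : Fin 5) : ∃ x : Fin 5, x ≠ a ∧ x ≠ b ∧ x ≠ c ∧ x ≠ d := by
  revert a b c d; decide

lemma exists_color_lt_three (a b : Fin 5) : ∃ x : Fin 5, x < 3 ∧ x ≠ a ∧ x ≠ b := by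
  revert a b; decide

/-- The number of moves of `l` that concern `p` or `q`. -/
noncomputable def cnt₂ (p q : V) (l : List (V × Fin 5)) : ℕ :=
  l.countP fun m => m.1 = p ∨ m.1 = q

lemma cnt₂_le (p q : V) (l : List (V × Fin 5)) : cnt₂ p q l ≤ cnt p l + cnt q l := by
  induction l with
  | nil => simp [cnt₂]
  | cons m l ih =>
    simp only [cnt₂, cnt_cons, List.countP_cons, decide_eq_true_eq] at ih ⊢
    split_ifs <;> first | omega | simp_all

lemma cnt₂_self (p : V) (l : List (V × Fin 5)) : cnt₂ p p l = cnt p l := by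
  simp [cnt₂, cnt]

/-- A bag whose vertices are split into independent sets `A` and `B`, and whose neighbors in `U`
are among `p` and `q`. All vertices `v` of the bag but possibly one vertex `z` of `B` have at
most one neighbor `par v` in `U`. -/
structure PathBag (G : SimpleGraph V) (U A B : Set V) (z p q : V) (par : V → V) : Prop where
  disj : Disjoint U (A ∪ B)
  disjAB : Disjoint A B
  indA : ∀ v ∈ A, ∀ w ∈ A, ¬ G.Adj v w
  indB : ∀ v ∈ B, ∀ w ∈ B, ¬ G.Adj v w
  z_notMem : z ∉ A
  p_mem : p ∈ U
  q_mem : q ∈ U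
  par_eq : ∀ v, par v = p ∨ par v = q
  par_adj : ∀ v ∈ A ∪ B, v ≠ z → ∀ u ∈ U, G.Adj v u → u = par v
  hub : ∀ v ∈ A ∪ B, ∀ u ∈ U, G.Adj v u → u = p ∨ u = q
  sib : ∀ v ∈ B, ∃ s₁ s₂, ∀ w ∈ A, G.Adj v w → w = s₁ ∨ w = s₂

namespace PathBag

lemma par_mem (h : PathBag G U A B z p q par) (v : V) : par v ∈ U :=
  (h.par_eq v).elim (fun e => e ▸ h.p_mem) fun e => e ▸ h.q_mem

lemma notMem_A (h : PathBag G U A B z p q par) {v : V} (hv : v ∈ U) : v ∉ A :=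
  fun hA => h.disj.le_bot ⟨hv, Or.inl hA⟩

lemma notMem_B (h : PathBag G U A B z p q par) {v : V} (hv : v ∈ U) : v ∉ B :=
  fun hB => h.disj.le_bot ⟨hv, Or.inr hB⟩

lemma notMem_B_of_mem_A (h : PathBag G U A B z p q par) {v : V} (hv : v ∈ A) : v ∉ B :=
  fun hB => h.disjAB.le_bot ⟨hv, hB⟩

/-- The bag avoids color `4`, and all of `B` has the same color. -/
def Clean (A B : Set V) (p q : V) (c : V → Fin 5) : Prop :=
  ∃ b : Fin 5, b ≠ 4 ∧ (∀ v ∈ B, c v = b) ∧ c p ≠ b ∧ c q ≠ b ∧ ∀ v ∈ A, c v ≠ 4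

lemma Clean.ne {v : V} (hc : Clean A B p q c) (hv : v ∈ A ∪ B) : c v ≠ 4 := by
  obtain ⟨b, hb, hB, -, -, hA⟩ := hc
  exact hv.elim (hA v) fun h => (hB v h).symm ▸ hb

variable [Finite V]

lemma exists_ext_recolor_A (h : PathBag G U A B z p q par) {M : Set V} (hM : M ⊆ A)
    (f : V → Fin 5) (c : V → Fin 5) (hpar : ∀ v ∈ M, c (par v) ≠ f v)
    (hB : ∀ v ∈ M, ∀ w ∈ B, c w ≠ f v) :
    ∃ r, Ext G U (A ∪ B) (fun m => m.1 ∈ M ∧ m.2 = f m.1) (fun v => if v ∈ M then 1 else 0)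
        c [] r ∧ run c r = fun v => if v ∈ M then f v else c v := by
  refine exists_ext_recolor h.disj (hM.trans Set.subset_union_left)
    (fun v hv w hw => h.indA v (hM hv) w (hM hw)) f c ?_
  rintro v hv w (hw | hw | hw) a
  · rw [h.par_adj v (Or.inl (hM hv)) (fun e => h.z_notMem (e ▸ hM hv)) w hw a]
    exact hpar v hv
  · exact absurd a (h.indA v (hM hv) w hw)
  · exact hB v hv w hw

/-- Recoloring some vertices of `A`, and then giving a common color to all vertices of `B`. -/
lemma exists_ext_recolor_AB (h : PathBag G U A B z p q par) {M : Set V} (hM : M ⊆ A)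
    (f : V → Fin 5) (b : Fin 5) (c : V → Fin 5) (hpar : ∀ v ∈ M, c (par v) ≠ f v)
    (hB : ∀ v ∈ M, ∀ w ∈ B, c w ≠ f v) (hfb : ∀ v ∈ M, f v ≠ b)
    (hA : ∀ v ∈ A, v ∉ M → c v ≠ b) (hp : c p ≠ b) (hq : c q ≠ b) :
    ∃ r, Ext G U (A ∪ B) (fun m => m.1 ∈ M ∧ m.2 = f m.1 ∨ m.1 ∈ B ∧ m.2 = b) (fun _ => 1)
        c [] r ∧ run c r = fun v => if v ∈ B then b else if v ∈ M then f v else c v := by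
  obtain ⟨r₁, hr₁, e₁⟩ := h.exists_ext_recolor_A hM f c hpar hB
  have hU : ∀ v ∈ U, run c r₁ v = c v := fun v hv => hr₁.run_eq v hv
  obtain ⟨r₂, hr₂, e₂⟩ := exists_ext_recolor (M := B) h.disj Set.subset_union_right h.indB
    (fun _ => b) (run c r₁) (by
      rintro v hv w (hw | hw | hw) a
      · rw [hU w hw]
        rcases h.hub v (Or.inr hv) w hw a with rfl | rfl
        exacts [hp, hq]
      · rw [e₁]
        by_cases hwM : w ∈ M
        · simpa [hwM] using hfb w hwM
        · simpa [hwM] using hA w hw hwM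
      · exact absurd a (h.indB v hv w hw))
  refine ⟨r₁ ++ r₂, ((hr₁.mono (fun m _ hm => Or.inl hm) fun _ _ => le_rfl).append
    (hr₂.mono (fun m _ hm => Or.inr hm) fun _ _ => le_rfl)).mono (fun _ _ h => h) ?_, ?_⟩
  · intro v _
    by_cases hvM : v ∈ M
    · simp [hvM, h.notMem_B_of_mem_A (hM hvM)]
    · simp only [hvM, if_false, zero_add]; split_ifs <;> omega
  · rw [run_append, e₂, e₁]

lemma exists_ext_to_clean (h : PathBag G U A B z p q par) (c : V → Fin 5) :
    ∃ r, Ext G U (A ∪ B) (fun _ => True) (fun _ => 2) c [] r ∧ Clean A B p q (run c r) := by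
  obtain ⟨a, ha4, hap, haq, haz⟩ := exists_color_ne₄ 4 (c p) (c q) (c z)
  obtain ⟨b, hb4, hbp, hbq, hba⟩ := exists_color_ne₄ 4 (c p) (c q) a
  have hf : ∀ v, ∃ x : Fin 5, v ∈ B → x ≠ a ∧ c (par v) ≠ x ∧ ∀ w ∈ A, G.Adj v w → c w ≠ x := by
    intro v
    by_cases hv : v ∈ B
    · obtain ⟨s₁, s₂, hs⟩ := h.sib v hv
      obtain ⟨x, h1, h2, h3, h4⟩ := exists_color_ne₄ a (c (par v)) (c s₁) (c s₂)
      refine ⟨x, fun _ => ⟨h1, h2.symm, fun w hw a => ?_⟩⟩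
      rcases hs w hw a with rfl | rfl
      exacts [h3.symm, h4.symm]
    · exact ⟨0, fun h => absurd h hv⟩
  choose f hf using hf
  obtain ⟨r₁, hr₁, e₁⟩ := exists_ext_recolor (M := {v | v ∈ B ∧ c v = a}) h.disj
    (fun v hv => Or.inr hv.1) (fun v hv w hw => h.indB v hv.1 w hw.1) f c (by
      rintro v ⟨hv, hva⟩ w (hw | hw | hw) hadj
      · rw [h.par_adj v (Or.inr hv) (by rintro rfl; exact haz hva.symm) w hw hadj]
        exact (hf v hv).2.1
      · exact (hf v hv).2.2 w hw hadj
      · exact absurd hadj (h.indB v hv w hw))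
  have hU : ∀ v ∈ U, run c r₁ v = c v := fun v hv => hr₁.run_eq v hv
  obtain ⟨r₂, hr₂, e₂⟩ := h.exists_ext_recolor_AB (M := A) subset_rfl (fun _ => a) b (run c r₁)
    (fun v _ => by
      rw [hU _ (h.par_mem v)]
      rcases h.par_eq v with e | e <;> rw [e]
      exacts [hap.symm, haq.symm])
    (fun v _ w hw => by
      rw [e₁]
      by_cases hwa : c w = a
      · simpa [hw, hwa] using (hf w hw).1
      · simp [hwa])
    (fun _ _ => hba.symm) (fun v hv hv' => absurd hv hv')
    (by rw [hU p h.p_mem]; exact hbp.symm) (by rw [hU q h.q_mem]; exact hbq.symm)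
  refine ⟨r₁ ++ r₂, ((hr₁.mono (fun _ _ _ => trivial) fun _ _ => le_rfl).append
    (hr₂.mono (fun _ _ _ => trivial) fun _ _ => le_rfl)).mono (fun _ _ h => h) ?_, ?_⟩
  · intro v _; split_ifs <;> omega
  · rw [run_append, e₂]
    refine ⟨b, hb4, fun v hv => by simp [hv], ?_, ?_, ?_⟩
    · simpa [h.notMem_A h.p_mem, h.notMem_B h.p_mem, hU p h.p_mem] using hbp.symm
    · simpa [h.notMem_A h.q_mem, h.notMem_B h.q_mem, hU q h.q_mem] using hbq.symm
    · intro v hv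
      simpa [hv, h.notMem_B_of_mem_A hv] using ha4

lemma exists_ext_clean_step (h : PathBag G U A B z p q par) {c : V → Fin 5}
    (hc : Clean A B p q c) {m : V × Fin 5} (hm : m.1 ∈ U) :
    ∃ r, Ext G U (A ∪ B) (fun m => m.2 ≠ 4)
        (fun _ => if m.1 = p ∨ m.1 = q then 1 else 0) c [] r ∧
      (∀ w ∈ A ∪ B, G.Adj m.1 w → run c r w ≠ m.2) ∧
      Clean A B p q (Function.update (run c r) m.1 m.2) := by
  obtain ⟨b, hb4, hbB, hbp, hbq, hA4⟩ := hc
  by_cases hmp : m.1 = p ∨ m.1 = q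
  swap
  · push Not at hmp
    refine ⟨[], Ext.nil.mono (fun _ _ h => h) (by simp), ?_, b, hb4, ?_⟩
    · intro w hw a
      rcases h.hub w hw _ hm a.symm with e | e
      exacts [absurd e hmp.1, absurd e hmp.2]
    · have hne : ∀ v ∈ A ∪ B, v ≠ m.1 := fun v hv e => h.disj.le_bot ⟨hm, e ▸ hv⟩
      refine ⟨fun v hv => ?_, ?_, ?_, fun v hv => ?_⟩
      · simpa [hne v (Or.inr hv)] using hbB v hv
      · simpa [hmp.1.symm] using hbp
      · simpa [hmp.2.symm] using hbq
      · simpa [hne v (Or.inl hv)] using hA4 v hv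
  obtain ⟨b', hb'4, hb'p, hb'q, hb'm, hb'⟩ : ∃ b' : Fin 5, b' ≠ 4 ∧ b' ≠ c p ∧ b' ≠ c q ∧
      b' ≠ m.2 ∧ (b' = b ∨ m.2 = b) := by
    by_cases hbm : b = m.2
    · obtain ⟨x, h1, h2, h3, h4⟩ := exists_color_ne₄ 4 (c p) (c q) m.2
      exact ⟨x, h1, h2, h3, h4, Or.inr hbm.symm⟩
    · exact ⟨b, hb4, hbp.symm, hbq.symm, hbm, Or.inl rfl⟩
  have hf : ∀ v, ∃ x : Fin 5, x ≠ 4 ∧ x ≠ c (par v) ∧ x ≠ b ∧ x ≠ b' ∧ x ≠ m.2 := by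
    intro v
    rcases hb' with e | e
    · obtain ⟨x, h1, h2, h3, h4⟩ := exists_color_ne₄ 4 (c (par v)) b m.2
      exact ⟨x, h1, h2, h3, e ▸ h3, h4⟩
    · obtain ⟨x, h1, h2, h3, h4⟩ := exists_color_ne₄ 4 (c (par v)) b b'
      exact ⟨x, h1, h2, h3, h4, e ▸ h3⟩
  choose f hf4 hfp hfb hfb' hfm using hf
  obtain ⟨r, hr, e⟩ := h.exists_ext_recolor_AB (M := {v | v ∈ A ∧ (c v = b' ∨ c v = m.2)})
    (fun v hv => hv.1) f b' c (fun v _ => (hfp v).symm)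
    (fun v _ w hw => by rw [hbB w hw]; exact (hfb v).symm) (fun v _ => hfb' v)
    (fun v hv hv' e => hv' ⟨hv, Or.inl e⟩) hb'p.symm hb'q.symm
  have hrun : ∀ w ∈ A ∪ B, run c r w ≠ m.2 ∧ run c r w ≠ 4 ∧ (w ∈ B → run c r w = b') := by
    intro w hw
    rw [e]
    by_cases hwB : w ∈ B
    · simp [hwB, hb'm, hb'4]
    · have hwA : w ∈ A := hw.resolve_right hwB
      by_cases hwM : c w = b' ∨ c w = m.2
      · simp [hwB, hwA, hwM, hfm, hf4]
      · have := hA4 w hwA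
        push Not at hwM
        simp [hwB, hwM, this]
  have hU : ∀ v ∈ U, run c r v = c v := fun v hv => hr.run_eq v hv
  have hne : ∀ v ∈ A ∪ B, v ≠ m.1 := fun v hv e => h.disj.le_bot ⟨hm, e ▸ hv⟩
  refine ⟨r, hr.mono ?_ (by simp [hmp]), fun w hw _ => (hrun w hw).1, b', hb'4, ?_, ?_, ?_, ?_⟩
  · rintro m' _ (⟨_, e⟩ | ⟨_, e⟩) <;> rw [e]
    exacts [hf4 _, hb'4]
  · intro v hv
    rw [Function.update_of_ne (hne v (Or.inr hv))]
    exact (hrun v (Or.inr hv)).2.2 hv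
  · by_cases hp : p = m.1
    · rw [← hp, Function.update_self]; exact hb'm.symm
    · rw [Function.update_of_ne hp, hU p h.p_mem]; exact hb'p.symm
  · by_cases hq : q = m.1
    · rw [← hq, Function.update_self]; exact hb'm.symm
    · rw [Function.update_of_ne hq, hU q h.q_mem]; exact hb'q.symm
  · intro v hv
    rw [Function.update_of_ne (hne v (Or.inl hv))]
    exact (hrun v (Or.inl hv)).2.1

lemma exists_ext_clean (h : PathBag G U A B z p q par) (hc : Clean A B p q c)
    (hl : Valid G U c l) :
    ∃ l', Ext G U (A ∪ B) (fun m => m.2 ≠ 4) (fun _ => cnt₂ p q l) c l l' ∧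
      Clean A B p q (run c l') := by
  obtain ⟨l', h₁, h₂⟩ := exists_ext_of_response (T := fun m => m.2 ≠ 4) h.disj (Clean A B p q)
    (fun _ => True) (fun _ m => m.1 = p ∨ m.1 = q)
    (fun _ _ hc hm _ _ => by convert h.exists_ext_clean_step hc hm) l c hc hl fun _ _ => trivial
  exact ⟨l', by convert h₁; simp [cnt₂], h₂⟩

/-- `l₁ ++ l₂` moves `v` at most twice in `l₁`, and `v` avoids color `4` afterwards. -/
structure PreB (c : V → Fin 5) (l₁ l₂ : List (V × Fin 5)) (v : V) : Prop where
  cnt₁ : cnt v l₁ ≤ 2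
  cnt₂ : cnt v l₂ ≤ 40
  run_ne : run c l₁ v ≠ 4
  ne : ∀ m ∈ l₂, m.1 = v → m.2 ≠ 4

/-- In `l₁ ++ l₂ ++ l₃`, the vertex `v` is seldom moved in `l₁` and `l₃`, and during `l₂` either
it keeps color `4` or it only has colors smaller than `3`. -/
structure PreC (c : V → Fin 5) (l₁ l₂ l₃ : List (V × Fin 5)) (v : V) : Prop where
  cnt₁ : cnt v l₁ ≤ 7
  cnt₃ : cnt v l₃ ≤ 1
  mid : (run c l₁ v = 4 ∧ ∀ m ∈ l₂, m.1 ≠ v) ∨ (run c l₁ v < 3 ∧ ∀ m ∈ l₂, m.1 = v → m.2 < 3)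

lemma exists_ext_of_cnt₂_le (h : PathBag G U A B z p q par) (hl : Valid G U c l)
    (hcnt : Recoloring.cnt₂ p q l ≤ 40) :
    ∃ l₁ l₂, Ext G U (A ∪ B) (fun _ => True) (fun _ => 48) c l (l₁ ++ l₂) ∧
      ∀ v ∈ A ∪ B, run c (l₁ ++ l₂) v ≠ 4 ∧ PreB c l₁ l₂ v := by
  obtain ⟨r, hr, hc⟩ := h.exists_ext_to_clean c
  obtain ⟨l', hl', hc'⟩ := h.exists_ext_clean hc (l := l) (hr.valid_of_append (l₂ := l) hl)
  refine ⟨r, l', (hr.append (hl'.mono (fun _ _ _ => trivial) fun _ _ => le_rfl)).mono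
    (fun _ _ h => h) fun v _ => by omega, fun v hv => ⟨?_, ?_, ?_, ?_, ?_⟩⟩
  · rw [run_append]; exact hc'.ne hv
  · exact hr.cnt_le v hv
  · exact (hl'.cnt_le v hv).trans hcnt
  · exact hc.ne hv
  · rintro m hm rfl
    exact hl'.tgt m hm fun hU => h.disj.le_bot ⟨hU, hv⟩

lemma exists_ext_mid (h : PathBag G U A B z p q par) (hB : ∀ v ∈ B, c v = 4)
    (hA : ∀ v ∈ A, c v < 3) (hl : Valid G U c l)
    (hpq : ∀ m ∈ l, m.1 = p ∨ m.1 = q → m.2 ≠ 4) :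
    ∃ l', Ext G U (A ∪ B) (fun m => m.1 ∈ A ∧ m.2 < 3) (fun v => if v ∈ A then cnt (par v) l else 0)
        c l l' ∧ (∀ v ∈ B, run c l' v = 4) ∧ ∀ v ∈ A, run c l' v < 3 := by
  have step : ∀ (c : V → Fin 5) (m : V × Fin 5), ((∀ v ∈ B, c v = 4) ∧ ∀ v ∈ A, c v < 3) →
      m.1 ∈ U → (m.1 = p ∨ m.1 = q → m.2 ≠ 4) → (∀ w ∈ U, G.Adj m.1 w → c w ≠ m.2) →
      ∃ r, Ext G U (A ∪ B) (fun m => m.1 ∈ A ∧ m.2 < 3)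
          (fun v => if v ∈ A ∧ m.1 = par v then 1 else 0) c [] r ∧
        (∀ w ∈ A ∪ B, G.Adj m.1 w → run c r w ≠ m.2) ∧
        (∀ v ∈ B, Function.update (run c r) m.1 m.2 v = 4) ∧
        ∀ v ∈ A, Function.update (run c r) m.1 m.2 v < 3 := by
    rintro c m ⟨hB, hA⟩ hm hpq -
    choose f hf3 hfp hfm using fun v => exists_color_lt_three (c (par v)) m.2
    obtain ⟨r, hr, e⟩ := h.exists_ext_recolor_A (M := {v | v ∈ A ∧ c v = m.2 ∧ m.1 = par v})
      (fun v hv => hv.1) f c (fun v _ => (hfp v).symm) (fun v _ w hw => by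
        rw [hB w hw]; exact fun e => by simpa [← e] using hf3 v)
    have hne : ∀ v ∈ A ∪ B, v ≠ m.1 := fun v hv e => h.disj.le_bot ⟨hm, e ▸ hv⟩
    have hrB : ∀ v ∈ B, run c r v = 4 := fun v hv => by
      have : v ∉ A := fun hA => h.notMem_B_of_mem_A hA hv
      simp [e, this, hB v hv]
    refine ⟨r, hr.mono ?_ fun v _ => ?_, ?_, ?_, ?_⟩
    · rintro m' _ ⟨h1, h2⟩
      exact ⟨h1.1, h2 ▸ hf3 _⟩
    · by_cases hv : v ∈ {v | v ∈ A ∧ c v = m.2 ∧ m.1 = par v}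
      · rw [if_pos hv, if_pos ⟨hv.1, hv.2.2⟩]
      · rw [if_neg hv]; exact Nat.zero_le _
    · rintro w (hw | hw) hadj
      · have hp : m.1 = par w :=
          h.par_adj w (Or.inl hw) (fun e => h.z_notMem (e ▸ hw)) _ hm hadj.symm
        rw [e]
        by_cases hwm : c w = m.2
        · simpa [hw, hwm, ← hp] using hfm w
        · simp [hwm]
      · rw [hrB w hw]
        exact (hpq (h.hub w (Or.inr hw) _ hm hadj.symm)).symm
    · intro v hv
      rw [Function.update_of_ne (hne v (Or.inr hv))]
      exact hrB v hv
    · intro v hv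
      rw [Function.update_of_ne (hne v (Or.inl hv)), e]
      dsimp only
      split_ifs
      exacts [hf3 v, hA v hv]
  obtain ⟨l', h₁, h₂⟩ := exists_ext_of_response (G := G) (T := fun m => m.1 ∈ A ∧ m.2 < 3) h.disj
    (fun c => (∀ v ∈ B, c v = 4) ∧ ∀ v ∈ A, c v < 3) (fun m => m.1 = p ∨ m.1 = q → m.2 ≠ 4)
    (fun v m => v ∈ A ∧ m.1 = par v) (fun c m h₁ h₂ h₃ h₄ => by convert step c m h₁ h₂ h₃ h₄)
    l c ⟨hB, hA⟩ hl hpq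
  refine ⟨l', h₁.mono (fun _ _ h => h) fun v _ => ?_, h₂⟩
  by_cases hv : v ∈ A <;> simp [hv, cnt]

lemma exists_ext_of_preB (h : PathBag G U A B z p q par) {l₁ l₂ : List (V × Fin 5)}
    (hl : Valid G U c (l₁ ++ l₂)) (hp : PreB c l₁ l₂ p) (hq : PreB c l₁ l₂ q) :
    ∃ l₁' l₂' l₃', Ext G U (A ∪ B) (fun _ => True) (fun _ => 48) c (l₁ ++ l₂)
        (l₁' ++ l₂' ++ l₃') ∧
      ∀ v ∈ A ∪ B, run c (l₁' ++ l₂' ++ l₃') v ≠ 4 ∧ PreC c l₁' l₂' l₃' v := by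
  obtain ⟨r, hr, hc⟩ := h.exists_ext_to_clean c
  obtain ⟨l', hl', b, hb4, hbB, hbp, hbq, hA4⟩ := h.exists_ext_clean hc (l := l₁)
    (hr.valid_of_append (l₂ := l₁) ((valid_append ..).1 hl).1)
  have h₁ := hr.append (hl'.mono (T' := fun _ => True) (fun _ _ _ => trivial) fun _ _ => le_rfl)
  rw [List.nil_append] at h₁
  rw [← run_append] at hbB hbp hbq hA4
  set c₁ := run c (r ++ l') with hc₁
  have hc₁U : ∀ v ∈ U, c₁ v = run c l₁ v := h₁.run_eq
  choose f hf3 hfp hfb using fun v => exists_color_lt_three (c₁ (par v)) b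
  obtain ⟨r₂, hr₂, e₂⟩ := h.exists_ext_recolor_AB (M := {v | v ∈ A ∧ c₁ v = 3})
    (fun v hv => hv.1) f 4 c₁ (fun v _ => (hfp v).symm)
    (fun v _ w hw => by rw [hbB w hw]; exact (hfb v).symm)
    (fun v _ e => by simpa [e] using hf3 v)
    (fun v hv _ => hA4 v hv) (by rw [hc₁U p h.p_mem]; exact hp.run_ne)
    (by rw [hc₁U q h.q_mem]; exact hq.run_ne)
  have h₂ := h₁.append (hr₂.mono (T' := fun _ => True) (fun _ _ _ => trivial) fun _ _ => le_rfl)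
  rw [List.append_nil] at h₂
  have hB2 : ∀ v ∈ B, run c (r ++ l' ++ r₂) v = 4 := fun v hv => by
    rw [run_append, ← hc₁, e₂]; simp [hv]
  have hA2 : ∀ v ∈ A, run c (r ++ l' ++ r₂) v < 3 := fun v hv => by
    have := hA4 v hv
    by_cases hv3 : c₁ v = 3
    · rw [run_append, ← hc₁, e₂]
      simpa [hv, hv3, h.notMem_B_of_mem_A hv] using hf3 v
    · rw [run_append, ← hc₁, e₂]
      simp only [hv3, h.notMem_B_of_mem_A hv, Set.mem_ofPred_eq, and_false, if_false]
      generalize c₁ v = x at *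
      revert x; decide
  obtain ⟨l₂', hl₂', hB3, hA3⟩ := h.exists_ext_mid hB2 hA2 (h₂.valid_of_append hl) (by
    rintro m hm (rfl | rfl)
    exacts [hp.ne m hm rfl, hq.ne m hm rfl])
  have h₃ := h₂.append (hl₂'.mono (T' := fun _ => True) (fun _ _ _ => trivial) fun _ _ => le_rfl)
  rw [← run_append] at hB3 hA3
  set c₃ := run c (r ++ l' ++ r₂ ++ l₂') with hc₃
  obtain ⟨b', hb'4, hb'p, hb'q, -⟩ := exists_color_ne₄ 4 (c₃ p) (c₃ q) 0
  choose g hg4 hgp hgb _ using fun v => exists_color_ne₄ 4 (c₃ (par v)) b' 0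
  obtain ⟨r₄, hr₄, e₄⟩ := h.exists_ext_recolor_AB (M := {v | v ∈ A ∧ c₃ v = b'})
    (fun v hv => hv.1) g b' c₃ (fun v _ => (hgp v).symm)
    (fun v _ w hw => by rw [hB3 w hw]; exact (hg4 v).symm)
    (fun v _ => hgb v) (fun v hv hv' e => hv' ⟨hv, e⟩) hb'p.symm hb'q.symm
  have h₄ := h₃.append (hr₄.mono (T' := fun _ => True) (fun _ _ _ => trivial) fun _ _ => le_rfl)
  rw [List.append_nil] at h₄
  have hcl : Recoloring.cnt₂ p q l₁ ≤ 4 :=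
    (cnt₂_le p q l₁).trans (by have := hp.cnt₁; have := hq.cnt₁; omega)
  refine ⟨r ++ l' ++ r₂, l₂', r₄, h₄.mono (fun _ _ h => h) fun v _ => ?_, fun v hv =>
    ⟨?_, ?_, ?_, ?_⟩⟩
  · have : cnt (par v) l₂ ≤ 40 := by
      rcases h.par_eq v with e | e <;> rw [e]
      exacts [hp.cnt₂, hq.cnt₂]
    split_ifs <;> omega
  · rw [run_append, ← hc₃, e₄]
    by_cases hvB : v ∈ B
    · simpa [hvB] using hb'4
    · have hvA : v ∈ A := hv.resolve_right hvB
      by_cases hvb : c₃ v = b'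
      · simpa [hvB, hvA, hvb] using hg4 v
      · have := hA3 v hvA
        simp only [hvB, hvb, Set.mem_ofPred_eq, and_false, if_false]
        intro e
        simp [e] at this
  · exact (h₂.cnt_le v hv).trans (by omega)
  · exact hr₄.cnt_le v hv
  · have hvU : v ∉ U := fun hU => h.disj.le_bot ⟨hU, hv⟩
    by_cases hvB : v ∈ B
    · refine Or.inl ⟨hB2 v hvB, ?_⟩
      rintro m hm rfl
      exact h.notMem_B_of_mem_A (hl₂'.tgt m hm hvU).1 hvB
    · refine Or.inr ⟨hA2 v (hv.resolve_right hvB), ?_⟩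
      rintro m hm rfl
      exact (hl₂'.tgt m hm hvU).2

lemma exists_ext_of_preC (h : PathBag G U A B z p q par) {l₁ l₂ l₃ : List (V × Fin 5)}
    (hl : Valid G U c (l₁ ++ l₂ ++ l₃)) (hp : PreC c l₁ l₂ l₃ p) (hq : PreC c l₁ l₂ l₃ q) :
    ∃ l', Ext G U (A ∪ B) (fun _ => True) (fun _ => 20) c (l₁ ++ l₂ ++ l₃) l' ∧
      ∀ v ∈ A ∪ B, run c l' v ≠ 4 := by
  obtain ⟨r, hr, hc⟩ := h.exists_ext_to_clean c
  obtain ⟨l', hl', b, hb4, hbB, hbp, hbq, hA4⟩ := h.exists_ext_clean hc (l := l₁)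
    (hr.valid_of_append (l₂ := l₁) (by simp only [valid_append] at hl; exact hl.1.1))
  have h₁ := hr.append (hl'.mono (T' := fun _ => True) (fun _ _ _ => trivial) fun _ _ => le_rfl)
  rw [List.nil_append] at h₁
  rw [← run_append] at hbB hbp hbq hA4
  set c₁ := run c (r ++ l') with hc₁
  have hc₁U : ∀ v ∈ U, c₁ v = run c l₁ v := h₁.run_eq
  have hne3 : ∀ v ∈ U, PreC c l₁ l₂ l₃ v → c₁ v ≠ 3 := fun v hv hpre e => by
    rw [hc₁U v hv] at e
    rcases hpre.mid with ⟨e', -⟩ | ⟨e', -⟩ <;> simp [e] at e'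
  choose g hg3 hgp hgb using fun v => exists_color_lt_three (c₁ (par v)) b
  obtain ⟨r₂, hr₂, e₂⟩ := h.exists_ext_recolor_AB
    (M := {v | v ∈ A ∧ (c₁ (par v) ≠ 4 ∨ c₁ v = 3)})
    (fun v hv => hv.1) (fun v => if c₁ (par v) = 4 then g v else 4) 3 c₁
    (fun v _ => by
      split_ifs with h4
      exacts [(hgp v).symm, h4])
    (fun v _ w hw => by
      rw [hbB w hw]
      split_ifs
      exacts [(hgb v).symm, hb4])
    (fun v _ => by
      split_ifs
      exacts [fun e => by simpa [e] using hg3 v, by decide])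
    (fun v hv hv' e => hv' ⟨hv, Or.inr e⟩)
    (hne3 p h.p_mem hp) (hne3 q h.q_mem hq)
  have h₂ := h₁.append (hr₂.mono (T' := fun _ => True) (fun _ _ _ => trivial) fun _ _ => le_rfl)
  rw [List.append_nil] at h₂
  rw [List.append_assoc] at hl
  have hl₂ := ((valid_append ..).1 (h₂.valid_of_append hl)).1
  have hmid : ∀ m ∈ l₂, m.1 = p ∨ m.1 = q → m.2 < 3 ∧ run c l₁ m.1 ≠ 4 := by
    intro m hm hmpq
    have hpre : PreC c l₁ l₂ l₃ m.1 := by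
      rcases hmpq with e | e <;> rw [e]
      exacts [hp, hq]
    rcases hpre.mid with ⟨-, h0⟩ | ⟨h0, h1⟩
    · exact absurd rfl (h0 m hm)
    · exact ⟨h1 m hm rfl, fun e => by simp [e] at h0⟩
  set c₂ := run c (r ++ l' ++ r₂) with hc₂
  have e₂' : c₂ = fun v => if v ∈ B then 3 else if v ∈ A ∧ (c₁ (par v) ≠ 4 ∨ c₁ v = 3) then
      if c₁ (par v) = 4 then g v else 4 else c₁ v := by
    rw [hc₂, run_append, ← hc₁, e₂]; simp only [Set.mem_ofPred_eq]; congr!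
  have hB2 : ∀ v ∈ B, c₂ v = 3 := fun v hv => by simp [e₂', hv]
  have hA2 : ∀ v ∈ A, (run c l₁ (par v) ≠ 4 ∧ c₂ v = 4) ∨
      (run c l₁ (par v) = 4 ∧ c₂ v < 3) := fun v hv => by
    have hvB := h.notMem_B_of_mem_A hv
    rw [← hc₁U _ (h.par_mem v)]
    by_cases h4 : c₁ (par v) = 4
    · refine Or.inr ⟨h4, ?_⟩
      have := hA4 v hv
      have := hg3 v
      by_cases hv3 : c₁ v = 3
      · simpa [e₂', hvB, hv, h4, hv3]
      · simp only [e₂', hvB, hv, h4, hv3, if_false, ne_eq, not_true, or_self, and_false]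
        generalize c₁ v = x at *
        revert x; decide
    · exact Or.inl ⟨h4, by simp [e₂', hvB, hv, h4]⟩
  obtain ⟨l₂', hl₂', e₃⟩ := exists_ext_of_response (G := G) (T := fun _ => True) h.disj
    (fun c' => ∀ v ∈ A ∪ B, c' v = c₂ v)
    (fun m => m.1 = p ∨ m.1 = q → m.2 < 3 ∧ run c l₁ m.1 ≠ 4) (fun _ _ => False)
    (by
      intro c' m hc' hm hOK _
      refine ⟨[], by simpa using Ext.nil, fun w hw hadj e => ?_, fun v hv => ?_⟩
      · rw [run_nil, hc' w hw] at e
        have hm3 := hOK (h.hub w hw _ hm hadj.symm)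
        rcases hw with hw | hw
        · have hp : m.1 = par w :=
            h.par_adj w (Or.inl hw) (fun e => h.z_notMem (e ▸ hw)) _ hm hadj.symm
          rcases hA2 w hw with ⟨-, h4⟩ | ⟨h4, -⟩
          · rw [← e, h4] at hm3
            exact absurd hm3.1 (by decide)
          · exact hm3.2 (hp ▸ h4)
        · rw [← e, hB2 w hw] at hm3
          exact absurd hm3.1 (by decide)
      · have : v ≠ m.1 := fun e => h.disj.le_bot ⟨hm, e ▸ hv⟩
        rw [Function.update_of_ne this]
        exact hc' v hv) l₂ c₂ (fun _ _ => rfl) hl₂ hmid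
  have h₃ := h₂.append hl₂'
  rw [← run_append] at e₃
  set c₃ := run c (r ++ l' ++ r₂ ++ l₂') with hc₃
  have hc₃U : ∀ v ∈ U, c₃ v = run c (l₁ ++ l₂) v := h₃.run_eq
  have hne3' : ∀ v ∈ U, PreC c l₁ l₂ l₃ v → c₃ v ≠ 3 := fun v hv hpre e => by
    rw [hc₃U v hv, run_append] at e
    rcases hpre.mid with ⟨e', h1⟩ | ⟨e', h1⟩
    · rw [run_eq_of_forall_ne _ _ _ h1, e'] at e
      exact absurd e (by decide)
    · have := run_induction_color (run c l₁) l₂ v (· < 3) e' h1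
      rw [e] at this
      exact absurd this (by decide)
  choose f hf3 hfp _ using fun v => exists_color_lt_three (c₃ (par v)) 0
  obtain ⟨r₄, hr₄, e₄⟩ := h.exists_ext_recolor_A (M := {v | v ∈ A ∧ c₃ v = 4})
    (fun v hv => hv.1) f c₃ (fun v _ => (hfp v).symm)
    (fun v _ w hw e => by
      rw [e₃ w (Or.inr hw), hB2 w hw] at e
      simpa [← e] using hf3 v)
  have h₄ := h₃.append (hr₄.mono (T' := fun _ => True) (κ' := fun _ => 1)
    (fun _ _ _ => trivial) fun _ _ => by split_ifs <;> omega)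
  rw [List.append_nil] at h₄
  have hclean : Clean A B p q (run c (r ++ l' ++ r₂ ++ l₂' ++ r₄)) := by
    rw [run_append, ← hc₃, e₄]
    refine ⟨3, by decide, fun v hv => ?_, ?_, ?_, fun v hv => ?_⟩
    · have : v ∉ A := fun hA => h.notMem_B_of_mem_A hA hv
      simp [this, e₃ v (Or.inr hv), hB2 v hv]
    · simpa [h.notMem_A h.p_mem] using hne3' p h.p_mem hp
    · simpa [h.notMem_A h.q_mem] using hne3' q h.q_mem hq
    · by_cases hv4 : c₃ v = 4
      · simpa [hv, hv4] using fun e => by simpa [e] using hf3 v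
      · simp [hv4]
  obtain ⟨l₅, h₅', hc₅⟩ := h.exists_ext_clean hclean (l := l₃)
    (h₄.valid_of_append (by rw [List.append_assoc]; exact hl))
  have h₅ := h₄.append (h₅'.mono (T' := fun _ => True) (fun _ _ _ => trivial) fun _ _ => le_rfl)
  have hcl₁ : Recoloring.cnt₂ p q l₁ ≤ 14 :=
    (cnt₂_le p q l₁).trans (by have := hp.cnt₁; have := hq.cnt₁; omega)
  have hcl₃ : Recoloring.cnt₂ p q l₃ ≤ 2 :=
    (cnt₂_le p q l₃).trans (by have := hp.cnt₃; have := hq.cnt₃; omega)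
  refine ⟨_, h₅.mono (fun _ _ h => h) fun v _ => ?_, fun v hv => ?_⟩
  · simp; omega
  · rw [run_append]; exact hc₅.ne hv

end PathBag

end Bag

section Triangle

variable {V : Type} {G : SimpleGraph V} {U N : Set V} {p t₁ t₂ t₃ : V} {c : V → Fin 5}
  {l : List (V × Fin 5)}

lemma exists_split_of_cnt_le (p : V) (l : List (V × Fin 5)) {a b : ℕ} (h : cnt p l ≤ a + b) :
    ∃ l₁ l₂, l = l₁ ++ l₂ ∧ cnt p l₁ ≤ a ∧ cnt p l₂ ≤ b := by
  induction l generalizing a with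
  | nil => exact ⟨[], [], rfl, by simp⟩
  | cons m l ih =>
    rw [cnt_cons] at h
    by_cases hm : m.1 = p
    · rw [if_pos hm] at h
      cases a with
      | zero => exact ⟨[], m :: l, rfl, by simp, by rw [cnt_cons, if_pos hm]; omega⟩
      | succ a =>
        obtain ⟨l₁, l₂, rfl, h₁, h₂⟩ := ih (a := a) (by omega)
        exact ⟨m :: l₁, l₂, rfl, by rw [cnt_cons, if_pos hm]; omega, h₂⟩
    · rw [if_neg hm] at h
      obtain ⟨l₁, l₂, rfl, h₁, h₂⟩ := ih (a := a) (by omega)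
      exact ⟨m :: l₁, l₂, rfl, by rw [cnt_cons, if_neg hm]; omega, h₂⟩

lemma exists_split_at_first (p : V) (l : List (V × Fin 5)) {k : ℕ} (h : cnt p l = k + 1) :
    ∃ l₁ y l₂, l = l₁ ++ [(p, y)] ++ l₂ ∧ cnt p l₁ = 0 ∧ cnt p l₂ = k := by
  induction l with
  | nil => simp at h
  | cons m l ih =>
    rw [cnt_cons] at h
    by_cases hm : m.1 = p
    · rw [if_pos hm] at h
      exact ⟨[], m.2, l, by rw [← hm]; rfl, rfl, by omega⟩
    · rw [if_neg hm] at h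
      obtain ⟨l₁, y, l₂, rfl, h₁, h₂⟩ := ih (by omega)
      exact ⟨m :: l₁, y, l₂, rfl, by rw [cnt_cons, if_neg hm, h₁], h₂⟩

/-- A bag of three vertices whose neighbors in `U` are all equal to `p`. -/
structure TriangleBag (G : SimpleGraph V) (U N : Set V) (p t₁ t₂ t₃ : V) : Prop where
  disj : Disjoint U N
  p_mem : p ∈ U
  eq : N = {t₁, t₂, t₃}
  ne₁₂ : t₁ ≠ t₂
  ne₁₃ : t₁ ≠ t₃
  ne₂₃ : t₂ ≠ t₃
  hub : ∀ v ∈ N, ∀ u ∈ U, G.Adj v u → u = p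

/-- The vertices of `N` and the vertex `p` have distinct colors. -/
def Rainbow (N : Set V) (p : V) (c : V → Fin 5) : Prop :=
  (∀ v ∈ N, ∀ w ∈ N, v ≠ w → c v ≠ c w) ∧ ∀ v ∈ N, c v ≠ c p

lemma Rainbow.congr {c' : V → Fin 5} (hc : Rainbow N p c)
    (h : ∀ v ∈ N, c' v = c v) (hp : c' p = c p) : Rainbow N p c' :=
  ⟨fun v hv w hw => by rw [h v hv, h w hw]; exact hc.1 v hv w hw,
    fun v hv => by rw [h v hv, hp]; exact hc.2 v hv⟩

namespace TriangleBag

lemma ne_p (h : TriangleBag G U N p t₁ t₂ t₃) {v : V} (hv : v ∈ N) : v ≠ p :=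
  fun e => h.disj.le_bot ⟨h.p_mem, e ▸ hv⟩

lemma exists_hole (h : TriangleBag G U N p t₁ t₂ t₃) (c : V → Fin 5) :
    ∃ e, e ≠ c p ∧ ∀ v ∈ N, c v ≠ e := by
  obtain ⟨e, h0, h1, h2, h3⟩ := exists_color_ne₄ (c p) (c t₁) (c t₂) (c t₃)
  refine ⟨e, h0, ?_⟩
  rw [h.eq]
  rintro v (rfl | rfl | rfl)
  exacts [h1.symm, h2.symm, h3.symm]

lemma ext_single (h : TriangleBag G U N p t₁ t₂ t₃) {v : V} (hv : v ∈ N) {k : Fin 5}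
    (hp : c p ≠ k) (hN : ∀ w ∈ N, w ≠ v → c w ≠ k) :
    Ext G U N (fun _ => True) (fun w => if w = v then 1 else 0) c [] [(v, k)] where
  valid := by
    refine ⟨Or.inr hv, ?_, trivial⟩
    rintro w (hw | hw) a
    · exact h.hub v hv w hw a ▸ hp
    · exact hN w hw a.ne'
  filter_eq := by
    have : v ∉ U := fun hU => h.disj.le_bot ⟨hU, hv⟩
    simp [this]
  tgt _ _ _ := trivial
  cnt_le w _ := by simp [cnt_cons, eq_comm]

lemma exists_ext_quiet (h : TriangleBag G U N p t₁ t₂ t₃) (hl : Valid G U c l)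
    (hp : cnt p l = 0) :
    ∃ l', Ext G U N (fun _ => True) (fun _ => 0) c l l' ∧ (∀ v ∈ N, run c l' v = c v) ∧
      run c l' p = c p := by
  rw [cnt_eq_zero] at hp
  obtain ⟨l', h₁, h₂⟩ := exists_ext_of_response (G := G) (N := N) (T := fun _ => True) h.disj
    (fun c' => ∀ v ∈ N, c' v = c v) (fun m => m.1 ≠ p) (fun _ _ => False)
    (by
      intro c' m hc' hm hmp _
      refine ⟨[], by simpa using Ext.nil, fun w hw a => ?_, fun v hv => ?_⟩
      · exact absurd (h.hub w hw _ hm a.symm) hmp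
      · have : v ≠ m.1 := fun e => h.disj.le_bot ⟨hm, e ▸ hv⟩
        rw [Function.update_of_ne this]
        exact hc' v hv) l c (fun _ _ => rfl) hl hp
  exact ⟨l', by simpa using h₁, h₂, by
    rw [h₁.run_eq p h.p_mem, run_eq_of_forall_ne _ _ _ hp]⟩

/-- The vertex of `N` about to be hit by `p` moves to the free color. -/
lemma exists_ext_lazy (h : TriangleBag G U N p t₁ t₂ t₃) (hc : Rainbow N p c) {y : Fin 5}
    (hl : Valid G U c [(p, y)]) :
    ∃ l', Ext G U N (fun _ => True) (fun v => if c v = y then 1 else 0) c [(p, y)] l' ∧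
      Rainbow N p (run c l') ∧
      ∀ v ∈ N, c v = y → run c l' v ≠ c p ∧ ∀ w ∈ N, c w ≠ run c l' v := by
  by_cases hy : ∃ v ∈ N, c v = y
  · obtain ⟨v, hv, hvy⟩ := hy
    obtain ⟨e, hep, he⟩ := h.exists_hole c
    have h₁ := h.ext_single hv hep.symm fun w hw _ => he w hw
    have hrun : run c [(v, e)] = Function.update c v e := rfl
    have hey : e ≠ y := hvy ▸ (he v hv).symm
    have hwy : ∀ w ∈ N, w ≠ v → c w ≠ y := fun w hw hwv => hvy ▸ hc.1 w hw v hv hwv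
    have h₂ := h₁.append (Ext.single (c := run c [(v, e)]) h.disj (m := (p, y)) h.p_mem
      (by
        intro w hw a
        rw [h₁.run_eq w hw]
        exact hl.2.1 w hw a)
      (by
        intro w hw a
        rw [hrun]
        by_cases hwv : w = v
        · subst hwv; simpa using hey
        · rw [Function.update_of_ne hwv]; exact hwy w hw hwv))
    refine ⟨_, h₂.mono (fun _ _ h => h) fun w _ => ?_, ?_, ?_⟩
    · split_ifs with hw h' h' <;> first | omega | exact absurd (hw ▸ hvy) h'
    · simp only [List.singleton_append, run_cons, run_nil]
      refine ⟨fun u hu w hw huw => ?_, fun u hu => ?_⟩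
      · rw [Function.update_of_ne (h.ne_p hu), Function.update_of_ne (h.ne_p hw)]
        by_cases h1 : u = v
        · subst h1
          simpa [huw.symm] using (he w hw).symm
        · by_cases h2 : w = v
          · subst h2
            simpa [huw] using he u hu
          · simpa [h1, h2] using hc.1 u hu w hw huw
      · rw [Function.update_of_ne (h.ne_p hu), Function.update_self]
        by_cases h1 : u = v
        · subst h1; simpa using hey
        · simpa [h1] using hwy u hu h1
    · intro w hw hwy'
      have : w = v := by
        by_contra hwv; exact hwy w hw hwv hwy'
      subst this
      simpa [h.ne_p hw] using ⟨hep, he⟩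
  · push Not at hy
    refine ⟨[(p, y)], (Ext.single h.disj h.p_mem hl.2.1 fun w hw _ => hy w hw).mono
      (fun _ _ h => h) fun _ _ => Nat.zero_le _, ⟨fun u hu w hw huw => ?_, fun u hu => ?_⟩,
      fun v hv hvy => absurd hvy (hy v hv)⟩
    · simpa [h.ne_p hu, h.ne_p hw] using hc.1 u hu w hw huw
    · simpa [h.ne_p hu] using hy u hu

/-- Two consecutive moves of `p`, the first one hitting `i` and the second one moving to the free
color, answered with two moves of `j` and one move of `i`. -/
lemma exists_ext_swap (h : TriangleBag G U N p t₁ t₂ t₃) (hc : Rainbow N p c) {i j : V}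
    (hi : i ∈ N) (hj : j ∈ N) (hij : i ≠ j) {y : Fin 5} (hyp : y ≠ c p)
    (hy : ∀ w ∈ N, c w ≠ y) {l₂ : List (V × Fin 5)} (h₂ : cnt p l₂ = 0)
    (hl : Valid G U c ([(p, c i)] ++ l₂ ++ [(p, y)])) :
    ∃ l', Ext G U N (fun _ => True) (fun v => if v = j then 2 else 1) c
        ([(p, c i)] ++ l₂ ++ [(p, y)]) l' ∧ Rainbow N p (run c l') := by
  have hjp := h.ne_p hj
  have hip := h.ne_p hi
  have e₁ := h.ext_single hj hyp.symm fun w hw _ => hy w hw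
  set c₁ := Function.update c j y with hc₁
  have e₂ := e₁.append (h.ext_single (c := run c [(j, y)]) hi (k := c j)
    (by simpa [hjp.symm] using (hc.2 j hj).symm)
    (fun w hw hwi => by
      by_cases hwj : w = j
      · subst hwj; simpa using (hy w hw).symm
      · simpa [hwj] using hc.1 w hw j hj hwj))
  have e₃ := e₂.append (Ext.single (c := run c ([(j, y)] ++ [(i, c j)])) h.disj (m := (p, c i))
    h.p_mem (by
      intro w hw a
      rw [e₂.run_eq w hw]
      exact hl.2.1 w hw a)
    (by
      intro w hw a
      by_cases hwi : w = i
      · subst hwi; simpa using (hc.1 w hw j hj hij).symm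
      · by_cases hwj : w = j
        · subst hwj; simpa [hwi] using (hy i hi).symm
        · simpa [hwi, hwj] using hc.1 w hw i hi hwi))
  obtain ⟨l₂', e₄', hN₄, hp₄⟩ := h.exists_ext_quiet (l := l₂)
    (e₃.valid_of_append (l₂ := l₂) ((valid_append ..).1 hl).1) h₂
  have e₄ := e₃.append e₄'
  have hrun : ∀ w ∈ N, run c ([(j, y)] ++ [(i, c j)] ++ [(p, c i)] ++ l₂') w =
      if w = i then c j else if w = j then y else c w := by
    intro w hw
    rw [run_append, hN₄ w hw]
    by_cases hwi : w = i
    · subst hwi; simp [hip]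
    · by_cases hwj : w = j
      · subst hwj; simp [hjp, hwi]
      · simp [hwi, hwj, h.ne_p hw]
  have hrunp : run c ([(j, y)] ++ [(i, c j)] ++ [(p, c i)] ++ l₂') p = c i := by
    rw [run_append, hp₄]; simp
  have e₅ := e₄.append (h.ext_single hj (k := c p) (by rw [hrunp]; exact hc.2 i hi)
    fun w hw hwj => by
      rw [hrun w hw]
      split_ifs
      exacts [hc.2 j hj, hc.2 w hw])
  have hrun₅ : ∀ w ∈ N, run c ([(j, y)] ++ [(i, c j)] ++ [(p, c i)] ++ l₂' ++ [(j, c p)]) w =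
      if w = i then c j else if w = j then c p else c w := by
    intro w hw
    rw [run_append]
    by_cases hwj : w = j
    · subst hwj; simp [hij.symm]
    · rw [run_cons, run_nil, Function.update_of_ne hwj, hrun w hw]
      simp [hwj]
  have e₆ := e₅.append (Ext.single (m := (p, y)) h.disj h.p_mem
    (by
      intro w hw a
      rw [e₅.run_eq w hw]
      have := ((valid_append ..).1 hl).2.2.1 w hw a
      simpa using this)
    (by
      intro w hw a
      rw [hrun₅ w hw]
      split_ifs
      exacts [hy j hj, hyp.symm, hy w hw]))
  simp only [List.nil_append, List.append_nil] at e₆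
  refine ⟨_, (e₆.mono (fun _ _ h => h) fun v _ => ?_), ?_⟩
  · by_cases hvi : v = i
    · subst hvi; simp [hij]
    · by_cases hvj : v = j <;> simp [hvi, hvj, hij.symm]
  · rw [run_append]
    have hrun₆ : ∀ w ∈ N, run (run c ([(j, y)] ++ [(i, c j)] ++ [(p, c i)] ++ l₂' ++ [(j, c p)]))
        [(p, y)] w = if w = i then c j else if w = j then c p else c w := fun w hw => by
      rw [← hrun₅ w hw]
      exact Function.update_of_ne (h.ne_p hw) ..
    refine ⟨fun u hu w hw huw => ?_, fun u hu => ?_⟩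
    · rw [hrun₆ u hu, hrun₆ w hw]
      split_ifs with hui hwi hwj huj hwi hwj hwi hwj
      exacts [absurd (hui.trans hwi.symm) huw, hc.2 j hj, (hc.1 w hw j hj hwj).symm,
        (hc.2 j hj).symm, absurd (huj.trans hwj.symm) huw, (hc.2 w hw).symm,
        hc.1 u hu j hj huj, hc.2 u hu, hc.1 u hu w hw huw]
    · rw [hrun₆ u hu, run_cons, run_nil, Function.update_self]
      split_ifs
      exacts [hy j hj, hyp.symm, hy u hu]

/-- Answering two moves of `p` with at most two moves of `j` and one move of every other vertex. -/
lemma exists_ext_window (h : TriangleBag G U N p t₁ t₂ t₃) (hc : Rainbow N p c) {j : V}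
    (hj : j ∈ N) (hl : Valid G U c l) (hp : cnt p l ≤ 2) :
    ∃ l', Ext G U N (fun _ => True) (fun v => if v = j then 2 else 1) c l l' ∧
      Rainbow N p (run c l') := by
  rcases Nat.eq_zero_or_pos (cnt p l) with h0 | h0
  · obtain ⟨l', e, hN, hp'⟩ := h.exists_ext_quiet hl h0
    exact ⟨l', e.mono (fun _ _ h => h) fun _ _ => Nat.zero_le _, hc.congr hN hp'⟩
  obtain ⟨a, y₁, b, rfl, ha, hb⟩ := exists_split_at_first p l (k := cnt p l - 1) (by omega)
  have hla := ((valid_append ..).1 ((valid_append ..).1 hl).1).1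
  obtain ⟨a', ea, haN, hap⟩ := h.exists_ext_quiet hla ha
  have hca : Rainbow N p (run c a') := hc.congr haN hap
  have hl' : Valid G U (run c a') ([(p, y₁)] ++ b) :=
    ea.valid_of_append (by simpa using hl)
  obtain ⟨r₁, e₁, hc₁, hr₁⟩ := h.exists_ext_lazy hca ((valid_append ..).1 hl').1
  have hlb := e₁.valid_of_append hl'
  have ea₁ := ea.append e₁
  have hle : cnt p b ≤ 1 := by omega
  rcases Nat.eq_zero_or_pos (cnt p b) with h0 | h0
  · obtain ⟨b', eb, hbN, hbp⟩ := h.exists_ext_quiet hlb h0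
    rw [← run_append] at eb
    refine ⟨_, (ea₁.append eb).mono (fun _ _ h => h) fun v _ => ?_, ?_⟩
    · split_ifs <;> omega
    · simpa [run_append] using hc₁.congr hbN hbp
  obtain ⟨b₁, y₂, d, rfl, hb₁, hd⟩ := exists_split_at_first p b (k := 0) (by omega)
  obtain ⟨b', eb, hbN, hbp⟩ := h.exists_ext_quiet
    ((valid_append ..).1 ((valid_append ..).1 hlb).1).1 hb₁
  have hcb := hc₁.congr hbN hbp
  have hlb' := eb.valid_of_append (l₂ := [(p, y₂)] ++ d) (by simpa using hlb)
  suffices ∃ s, Ext G U N (fun _ => True) (fun v => if v = j then 2 else 1) (run c a')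
      ([(p, y₁)] ++ b₁ ++ [(p, y₂)]) s ∧ Rainbow N p (run (run c a') s) by
    obtain ⟨s, es, hs⟩ := this
    have hld := es.valid_of_append (l₂ := d) (by simpa using hl')
    obtain ⟨d', ed, hdN, hdp⟩ := h.exists_ext_quiet hld hd
    refine ⟨a' ++ (s ++ d'), ?_, ?_⟩
    · have := (ea.append (es.append ed)).mono (T' := fun _ => True)
        (κ' := fun v => if v = j then 2 else 1) (fun _ _ h => h) fun v _ => by omega
      simpa using this
    · rw [run_append, run_append]; exact hs.congr hdN hdp
  obtain ⟨r₂, e₂, hc₂, -⟩ := h.exists_ext_lazy hcb ((valid_append ..).1 hlb').1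
  rw [← run_append] at e₂
  have e₃ := (e₁.append eb).append e₂
  by_cases hbad : ∃ i ∈ N, i ≠ j ∧ run c a' i = y₁ ∧ run (run c a') (r₁ ++ b') i = y₂
  · obtain ⟨i, hi, hij, rfl, h2⟩ := hbad
    rw [run_append, hbN i hi] at h2
    obtain ⟨h3, h4⟩ := hr₁ i hi rfl
    rw [h2] at h3 h4
    exact h.exists_ext_swap hca hi hj hij h3 h4 hb₁
      ((valid_append _ _ d).1 (by simpa using hl')).1
  · push Not at hbad
    refine ⟨_, e₃.mono (fun _ _ h => h) fun v hv => ?_, ?_⟩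
    · have := hbad v hv
      split_ifs <;> simp_all
    · rw [run_append, run_append]; exact hc₂

lemma exists_ext_block (h : TriangleBag G U N p t₁ t₂ t₃) (k : ℕ) (hc : Rainbow N p c)
    (hl : Valid G U c l) (hp : cnt p l ≤ 6 * k) :
    ∃ l', Ext G U N (fun _ => True) (fun _ => 4 * k) c l l' ∧ Rainbow N p (run c l') := by
  induction k generalizing c l with
  | zero =>
    obtain ⟨l', e, hN, hp'⟩ := h.exists_ext_quiet hl (by omega)
    exact ⟨l', e, hc.congr hN hp'⟩
  | succ k ih =>
    obtain ⟨l₁, m₁, rfl, h₁, hm₁⟩ := exists_split_of_cnt_le p l (a := 2) (b := 6 * k + 4) (by omega)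
    obtain ⟨l₂, m₂, rfl, h₂, hm₂⟩ :=
      exists_split_of_cnt_le p m₁ (a := 2) (b := 6 * k + 2) (by omega)
    obtain ⟨l₃, l₄, rfl, h₃, h₄⟩ := exists_split_of_cnt_le p m₂ (a := 2) (b := 6 * k) (by omega)
    obtain ⟨s₁, e₁, c₁⟩ := h.exists_ext_window hc (j := t₁) (by simp [h.eq])
      ((valid_append ..).1 hl).1 h₁
    have v₁ := e₁.valid_of_append hl
    obtain ⟨s₂, e₂, c₂⟩ := h.exists_ext_window c₁ (j := t₂) (by simp [h.eq])
      ((valid_append ..).1 v₁).1 h₂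
    have v₂ := e₂.valid_of_append v₁
    obtain ⟨s₃, e₃, c₃⟩ := h.exists_ext_window c₂ (j := t₃) (by simp [h.eq])
      ((valid_append ..).1 v₂).1 h₃
    obtain ⟨s₄, e₄, c₄⟩ := ih c₃ (e₃.valid_of_append v₂) h₄
    refine ⟨_, (e₁.append (e₂.append (e₃.append e₄))).mono (fun _ _ h => h) fun v hv => ?_, by
      simpa [run_append] using c₄⟩
    have h12 := h.ne₁₂
    have h13 := h.ne₁₃
    have h23 := h.ne₂₃
    rw [h.eq] at hv
    rcases hv with rfl | rfl | rfl
    · simp [h12, h13]; omega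
    · simp [h12.symm, h23]; omega
    · simp [h13.symm, h23.symm]; omega

lemma exists_ext (h : TriangleBag G U N p t₁ t₂ t₃) (hc : Rainbow N p c)
    (hl : Valid G U c l) (hp : cnt p l ≤ 48) :
    ∃ l', Ext G U N (fun _ => True) (fun _ => 40) c l l' ∧ ∀ v ∈ N, run c l' v ≠ 4 := by
  obtain ⟨l', e, hc'⟩ := h.exists_ext_block 8 hc hl hp
  by_cases h4 : ∃ v ∈ N, run c l' v = 4
  · obtain ⟨v, hv, hv4⟩ := h4
    obtain ⟨k, hkp, hk⟩ := h.exists_hole (run c l')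
    have e' := e.append (h.ext_single hv hkp.symm fun w hw _ => hk w hw)
    rw [List.append_nil] at e'
    refine ⟨_, e'.mono (fun _ _ h => h) fun w _ => ?_, fun w hw => ?_⟩
    · split_ifs <;> omega
    · rw [run_append]
      by_cases hwv : w = v
      · subst hwv
        simpa using fun e => hk w hw (hv4.trans e.symm)
      · simpa [hwv] using fun e => hc'.1 w hw v hv hwv (e.trans hv4.symm)
  · push Not at h4
    exact ⟨l', e.mono (fun _ _ h => h) fun _ _ => by omega, h4⟩

end TriangleBag

end Triangle

section Structure

variable {V : Type} {G : SimpleGraph V}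

lemma exists_pair_of_no_three {S : V → Prop}
    (h : ∀ x y z, S x → S y → S z → x ≠ y → x ≠ z → y ≠ z → False) :
    (∀ x, ¬ S x) ∨ ∃ s₁ s₂, S s₁ ∧ S s₂ ∧ ∀ x, S x → x = s₁ ∨ x = s₂ := by
  by_cases h0 : ∃ x, S x
  · obtain ⟨x, hx⟩ := h0
    by_cases h1 : ∃ y, S y ∧ y ≠ x
    · obtain ⟨y, hy, hyx⟩ := h1
      refine Or.inr ⟨x, y, hx, hy, fun z hz => ?_⟩
      by_contra! hzxy
      exact h x y z hx hy hz hyx.symm hzxy.1.symm hzxy.2.symm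
    · push Not at h1
      exact Or.inr ⟨x, x, hx, hx, fun z hz => Or.inl (h1 z hz)⟩
  · exact Or.inl (not_exists.1 h0)

lemma connected_induce_singleton (v : V) : (G.induce {v}).Connected := by
  have : Nonempty ({v} : Set V) := ⟨⟨v, rfl⟩⟩
  have : Subsingleton ({v} : Set V) := (Set.subsingleton_coe _).2 Set.subsingleton_singleton
  exact ⟨Preconnected.of_subsingleton⟩

/-- Two hubs and three leaves form a `K_{2,3}` minor. -/
lemma isMinor_k23 {X Y L₁ L₂ L₃ : Set V} (hX : (G.induce X).Connected)
    (hY : (G.induce Y).Connected) (h₁ : (G.induce L₁).Connected) (h₂ : (G.induce L₂).Connected)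
    (h₃ : (G.induce L₃).Connected) (hXY : Disjoint X Y) (hX₁ : Disjoint X L₁)
    (hX₂ : Disjoint X L₂) (hX₃ : Disjoint X L₃) (hY₁ : Disjoint Y L₁) (hY₂ : Disjoint Y L₂)
    (hY₃ : Disjoint Y L₃) (h₁₂ : Disjoint L₁ L₂) (h₁₃ : Disjoint L₁ L₃) (h₂₃ : Disjoint L₂ L₃)
    (a₁ : ∃ u ∈ X, ∃ v ∈ L₁, G.Adj u v) (a₂ : ∃ u ∈ X, ∃ v ∈ L₂, G.Adj u v)
    (a₃ : ∃ u ∈ X, ∃ v ∈ L₃, G.Adj u v) (b₁ : ∃ u ∈ Y, ∃ v ∈ L₁, G.Adj u v)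
    (b₂ : ∃ u ∈ Y, ∃ v ∈ L₂, G.Adj u v) (b₃ : ∃ u ∈ Y, ∃ v ∈ L₃, G.Adj u v) :
    IsMinor (completeBipartiteGraph (Fin 2) (Fin 3)) G := by
  have key : ∀ i : Fin 2, ∀ j : Fin 3, ∃ u ∈ (![X, Y] : Fin 2 → Set V) i,
      ∃ v ∈ (![L₁, L₂, L₃] : Fin 3 → Set V) j, G.Adj u v := by
    intro i j
    fin_cases i <;> fin_cases j <;> assumption
  have conn : ∀ h, (G.induce
      ((Sum.elim ![X, Y] ![L₁, L₂, L₃] : Fin 2 ⊕ Fin 3 → Set V) h)).Connected := by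
    rintro (i | j)
    · fin_cases i <;> assumption
    · fin_cases j <;> assumption
  refine ⟨Sum.elim ![X, Y] ![L₁, L₂, L₃], fun h => ?_, ?_, conn, ?_⟩
  · obtain ⟨x⟩ := (conn h).nonempty
    exact ⟨x, x.2⟩
  · have d : ∀ i : Fin 2, ∀ j : Fin 3, Disjoint ((![X, Y] : Fin 2 → Set V) i)
        ((![L₁, L₂, L₃] : Fin 3 → Set V) j) := by
      intro i j
      fin_cases i <;> fin_cases j <;> assumption
    rintro (i | i) (j | j) hij
    · fin_cases i <;> fin_cases j <;> first | exact absurd rfl hij | assumption | exact hXY.symm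
    · exact d i j
    · exact (d j i).symm
    · fin_cases i <;> fin_cases j <;>
        first | exact absurd rfl hij | assumption | (apply Disjoint.symm; assumption)
  · rintro (i | i) (j | j) hij
    · simp at hij
    · exact key i j
    · obtain ⟨u, hu, v, hv, a⟩ := key j i
      exact ⟨v, hv, u, hu, a.symm⟩
    · simp at hij

/-- The inner vertices of a path whose ends are distinct and nonadjacent connect its ends. -/
lemma exists_connector {a b : V} (P : G.Walk a b) (hP : P.IsPath) (hne : a ≠ b)
    (hab : ¬ G.Adj a b) :
    ∃ Y : Set V, (G.induce Y).Connected ∧ (∀ y ∈ Y, y ∈ P.support) ∧ a ∉ Y ∧ b ∉ Y ∧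
      (∃ y ∈ Y, G.Adj a y) ∧ ∃ y ∈ Y, G.Adj b y := by
  cases P with
  | nil => exact absurd rfl hne
  | cons h P₁ =>
    cases P₁ with
    | nil => exact absurd h hab
    | cons h' P₂ =>
      obtain ⟨y, P₃, h'', e⟩ := Walk.exists_cons_eq_concat h' P₂
      rw [e] at hP ⊢
      rw [Walk.cons_isPath_iff, Walk.concat_isPath_iff, Walk.support_concat] at hP
      refine ⟨{v | v ∈ P₃.support}, P₃.connected_induce_support, fun v hv => ?_, ?_, hP.1.2,
        ⟨_, P₃.start_mem_support, h⟩, ⟨_, P₃.end_mem_support, h''.symm⟩⟩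
      · have : v ∈ P₃.support := hv
        simp [Walk.support_concat, this]
      · intro ha
        have : a ∈ P₃.support := ha
        simp [this] at hP

/-- The union of the connected subsets of `W` containing `v`. -/
def component (G : SimpleGraph V) (W : Set V) (v : V) : Set V :=
  ⋃₀ {C | v ∈ C ∧ C ⊆ W ∧ (G.induce C).Connected}

variable {W C : Set V} {v : V}

lemma component_subset : component G W v ⊆ W :=
  Set.sUnion_subset fun _ hC => hC.2.1

lemma mem_component (hv : v ∈ W) : v ∈ component G W v :=
  ⟨{v}, ⟨rfl, Set.singleton_subset_iff.2 hv, connected_induce_singleton v⟩, rfl⟩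

lemma connected_component (hv : v ∈ W) : (G.induce (component G W v)).Connected :=
  induce_sUnion_connected_of_pairwise_not_disjoint
    ⟨{v}, rfl, Set.singleton_subset_iff.2 hv, connected_induce_singleton v⟩
    (fun hs ht => ⟨v, hs.1, ht.1⟩) fun hs => hs.2.2

lemma subset_component_of_mem (hv : v ∈ W) (hCW : C ⊆ W) (hC : (G.induce C).Connected) {x : V}
    (hx : x ∈ C) (hxK : x ∈ component G W v) : C ⊆ component G W v := by
  refine (Set.subset_union_right (s := component G W v)).trans (Set.subset_sUnion_of_mem ?_)
  exact ⟨Or.inl (mem_component hv), Set.union_subset component_subset hCW,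
    induce_union_connected (connected_component hv).preconnected hC.preconnected ⟨x, hxK, hx⟩⟩

lemma mem_component_of_adj (hv : v ∈ W) {x y : V} (hx : x ∈ component G W v) (hy : y ∈ W)
    (a : G.Adj x y) : y ∈ component G W v :=
  subset_component_of_mem hv (Set.insert_subset_iff.2
    ⟨component_subset hx, Set.singleton_subset_iff.2 hy⟩)
    (induce_pair_connected_of_adj a) (Set.mem_insert ..) hx (Set.mem_insert_of_mem _ rfl)

/-- A nonempty proper subset of a connected set is joined to the rest by an edge. -/
lemma exists_adj_of_connected {K S : Set V} (hK : (G.induce K).Connected) {x y : V} (hx : x ∈ K)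
    (hxS : x ∈ S) (hy : y ∈ K) (hyS : y ∉ S) :
    ∃ u ∈ K ∩ S, ∃ w ∈ K \ S, G.Adj u w := by
  obtain ⟨p⟩ := hK.preconnected ⟨x, hx⟩ ⟨y, hy⟩
  obtain ⟨d, -, h1, h2⟩ := p.exists_boundary_dart {u | u.1 ∈ S} hxS hyS
  exact ⟨d.fst, ⟨d.fst.2, h1⟩, d.snd, ⟨d.snd.2, h2⟩, d.adj⟩

/-- `N` is a subset of `K` all of whose vertices have a neighbor in the connected set `R`, which
avoids `K`. -/
structure Layer (G : SimpleGraph V) (K N R : Set V) : Prop where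
  subset : N ⊆ K
  disj : Disjoint R K
  conn : (G.induce R).Connected
  adj : ∀ v ∈ N, ∃ u ∈ R, G.Adj u v

namespace Layer

variable {K N R : Set V}

lemma notMem (h : Layer G K N R) {x : V} (hx : x ∈ K) : x ∉ R :=
  fun hR => h.disj.le_bot ⟨hR, hx⟩

/-- A connected set and three of its neighbors in `N`. -/
lemma no_three_attachments (h : Layer G K N R)
    (hG : ¬ IsMinor (completeBipartiteGraph (Fin 2) (Fin 3)) G) {C : Set V} (hCK : C ⊆ K)
    (hC : (G.induce C).Connected) (x y z : V) (hx : x ∈ N ∧ x ∉ C ∧ ∃ u ∈ C, G.Adj u x)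
    (hy : y ∈ N ∧ y ∉ C ∧ ∃ u ∈ C, G.Adj u y) (hz : z ∈ N ∧ z ∉ C ∧ ∃ u ∈ C, G.Adj u z)
    (hxy : x ≠ y) (hxz : x ≠ z) (hyz : y ≠ z) : False := by
  refine hG (isMinor_k23 (X := C) (Y := R) (L₁ := {x}) (L₂ := {y}) (L₃ := {z}) hC h.conn
    (connected_induce_singleton _) (connected_induce_singleton _) (connected_induce_singleton _)
    ?_ ?_ ?_ ?_ ?_ ?_ ?_ ?_ ?_ ?_ ?_ ?_ ?_ ?_ ?_ ?_)
  · exact (h.disj.mono_right hCK).symm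
  · simpa using hx.2.1
  · simpa using hy.2.1
  · simpa using hz.2.1
  · simpa using h.notMem (h.subset hx.1)
  · simpa using h.notMem (h.subset hy.1)
  · simpa using h.notMem (h.subset hz.1)
  · simpa using hxy
  · simpa using hxz
  · simpa using hyz
  · simpa using hx.2.2
  · simpa using hy.2.2
  · simpa using hz.2.2
  · simpa using h.adj x hx.1
  · simpa using h.adj y hy.1
  · simpa using h.adj z hz.1

lemma no_three_neighbors (h : Layer G K N R)
    (hG : ¬ IsMinor (completeBipartiteGraph (Fin 2) (Fin 3)) G) {v : V} (hv : v ∈ N) (x y z : V)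
    (hx : x ∈ N ∧ G.Adj v x) (hy : y ∈ N ∧ G.Adj v y) (hz : z ∈ N ∧ G.Adj v z)
    (hxy : x ≠ y) (hxz : x ≠ z) (hyz : y ≠ z) : False :=
  h.no_three_attachments hG (Set.singleton_subset_iff.2 (h.subset hv))
    (connected_induce_singleton v) x y z ⟨hx.1, hx.2.ne.symm, v, rfl, hx.2⟩
    ⟨hy.1, hy.2.ne.symm, v, rfl, hy.2⟩ ⟨hz.1, hz.2.ne.symm, v, rfl, hz.2⟩ hxy hxz hyz

/-- The graph induced on `N` has a triangle or is bipartite. -/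
lemma exists_triangle_or_bipartite [Finite V] (h : Layer G K N R)
    (hG : ¬ IsMinor (completeBipartiteGraph (Fin 2) (Fin 3)) G) :
    (∃ t₁ ∈ N, ∃ t₂ ∈ N, ∃ t₃ ∈ N, G.Adj t₁ t₂ ∧ G.Adj t₁ t₃ ∧ G.Adj t₂ t₃) ∨
      ∃ f : V → Fin 2, ∀ u ∈ N, ∀ v ∈ N, G.Adj u v → f u ≠ f v := by
  by_contra! hcon
  obtain ⟨htri, hbip⟩ := hcon
  let G' : SimpleGraph V :=
    { Adj := fun u v => G.Adj u v ∧ u ∈ N ∧ v ∈ N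
      symm := ⟨fun _ _ h => ⟨h.1.symm, h.2.2, h.2.1⟩⟩
      loopless := ⟨fun _ h => h.1.ne rfl⟩ }
  have hle : G' ≤ G := fun _ _ h => h.1
  have hsupp : ∀ {x y : V} (P : G'.Walk x y), x ∈ N → ∀ v ∈ P.support, v ∈ N := by
    intro x y P hx
    induction P with
    | nil => simpa using hx
    | cons a P ih => simpa [hx] using ih a.2.2
  have hac : G'.IsAcyclic := by
    intro u w hw
    cases w with
    | nil => simp at hw
    | cons a P =>
      rename_i x
      rw [Walk.cons_isCycle_iff] at hw
      cases P with
      | nil => exact a.1.ne rfl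
      | cons a' P' =>
        obtain ⟨y, P₂, b, e⟩ := Walk.exists_cons_eq_concat a' P'
        rw [e, Walk.concat_isPath_iff] at hw
        obtain ⟨⟨hP₂, hu⟩, hedge⟩ := hw
        have hxy : x ≠ y := by
          rintro rfl
          simp [Walk.edges_concat, Sym2.eq_swap] at hedge
        have hnadj : ¬ G.Adj x y := fun hadj =>
          htri u a.2.1 x a.2.2 y b.2.1 a.1 b.1.symm hadj
        obtain ⟨Y, hYc, hYP, hxY, hyY, hx, hy⟩ := exists_connector (P₂.mapLe hle)
          ((Walk.isPath_mapLe hle).2 hP₂) hxy hnadj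
        have hYN : Y ⊆ N := fun v hv => hsupp P₂ a.2.2 v (by simpa using hYP v hv)
        have huY : u ∉ Y := fun h => hu (by simpa using hYP u h)
        refine hG (isMinor_k23 (X := {u}) (Y := Y) (L₁ := {x}) (L₂ := {y}) (L₃ := R)
          (connected_induce_singleton _) hYc (connected_induce_singleton _)
          (connected_induce_singleton _) h.conn
          ?_ ?_ ?_ ?_ ?_ ?_ ?_ ?_ ?_ ?_ ?_ ?_ ?_ ?_ ?_ ?_)
        · simpa using huY
        · simpa using a.1.ne
        · simpa using b.1.ne.symm
        · simpa using h.notMem (h.subset a.2.1)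
        · simpa using hxY
        · simpa using hyY
        · exact (h.disj.mono_right (hYN.trans h.subset)).symm
        · simpa using hxy
        · simpa using h.notMem (h.subset a.2.2)
        · simpa using h.notMem (h.subset b.2.1)
        · simpa using a.1
        · simpa using b.1.symm
        · simpa [G.adj_comm] using h.adj u a.2.1
        · simpa [G.adj_comm] using hx
        · simpa [G.adj_comm] using hy
        · obtain ⟨v, hv, -⟩ := hx
          obtain ⟨w, hw, b⟩ := h.adj v (hYN hv)
          exact ⟨v, hv, w, hw, b.symm⟩
  obtain ⟨f⟩ := hac.colorable_two
  obtain ⟨u, hu, v, hv, a, e⟩ := hbip f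
  exact f.valid (show G'.Adj u v from ⟨a, hu, hv⟩) e

lemma no_three_of_triangle (h : Layer G K N R)
    (hG : ¬ IsMinor (completeBipartiteGraph (Fin 2) (Fin 3)) G) {t₁ t₂ t₃ : V} (h₁ : t₁ ∈ N)
    (h₂ : t₂ ∈ N) (h₃ : t₃ ∈ N) (a₁₂ : G.Adj t₁ t₂) (a₁₃ : G.Adj t₁ t₃) (a₂₃ : G.Adj t₂ t₃)
    {C : Set V} (hCK : C ⊆ K) (hC : (G.induce C).Connected) (n₁ : t₁ ∉ C) (n₂ : t₂ ∉ C)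
    (n₃ : t₃ ∉ C) (hN : ∃ v ∈ C, v ∈ N) (ha : ∃ v ∈ C, G.Adj t₁ v) : False := by
  refine hG (isMinor_k23 (X := {t₁}) (Y := R) (L₁ := {t₂}) (L₂ := {t₃}) (L₃ := C)
    (connected_induce_singleton _) h.conn (connected_induce_singleton _)
    (connected_induce_singleton _) hC
    ?_ ?_ ?_ ?_ ?_ ?_ ?_ ?_ ?_ ?_ ?_ ?_ ?_ ?_ ?_ ?_)
  · simpa using h.notMem (h.subset h₁)
  · simpa using a₁₂.ne
  · simpa using a₁₃.ne
  · simpa using n₁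
  · simpa using h.notMem (h.subset h₂)
  · simpa using h.notMem (h.subset h₃)
  · exact h.disj.mono_right hCK
  · simpa using a₂₃.ne
  · simpa using n₂
  · simpa using n₃
  · simpa using a₁₂
  · simpa using a₁₃
  · simpa using ha
  · simpa using h.adj t₂ h₂
  · simpa using h.adj t₃ h₃
  · obtain ⟨v, hv, hvN⟩ := hN
    obtain ⟨u, hu, a⟩ := h.adj v hvN
    exact ⟨u, hu, v, hv, a⟩

/-- If `K` is connected, then a triangle in `N` is all of `N`. -/
lemma eq_of_triangle (h : Layer G K N R)
    (hG : ¬ IsMinor (completeBipartiteGraph (Fin 2) (Fin 3)) G) (hK : (G.induce K).Connected)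
    {t₁ t₂ t₃ : V} (h₁ : t₁ ∈ N) (h₂ : t₂ ∈ N) (h₃ : t₃ ∈ N) (a₁₂ : G.Adj t₁ t₂)
    (a₁₃ : G.Adj t₁ t₃) (a₂₃ : G.Adj t₂ t₃) : N = {t₁, t₂, t₃} := by
  refine Set.Subset.antisymm (fun u hu => ?_) ?_
  · by_contra hT
    have hu' : u ∈ K \ {t₁, t₂, t₃} := ⟨h.subset hu, hT⟩
    have hsub := component_subset (G := G) (W := K \ {t₁, t₂, t₃}) (v := u)
    have hn : ∀ t ∈ ({t₁, t₂, t₃} : Set V), t ∉ component G (K \ {t₁, t₂, t₃}) u :=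
      fun t ht htC => (hsub htC).2 ht
    have n₁ := hn t₁ (by simp)
    have n₂ := hn t₂ (by simp)
    have n₃ := hn t₃ (by simp)
    have hC := connected_component (G := G) hu'
    have hCK := hsub.trans Set.sdiff_subset
    have huC := mem_component (G := G) hu'
    obtain ⟨x, hx, w, hw, a⟩ := exists_adj_of_connected hK hu'.1 huC (h.subset h₁) n₁
    have hwT : w ∈ ({t₁, t₂, t₃} : Set V) := by
      by_contra hwT
      exact hw.2 (mem_component_of_adj hu' hx.2 ⟨hw.1, hwT⟩ a)
    rcases hwT with rfl | rfl | rfl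
    · exact h.no_three_of_triangle hG h₁ h₂ h₃ a₁₂ a₁₃ a₂₃ hCK hC n₁ n₂ n₃ ⟨u, huC, hu⟩
        ⟨x, hx.2, a.symm⟩
    · exact h.no_three_of_triangle hG h₂ h₁ h₃ a₁₂.symm a₂₃ a₁₃ hCK hC n₂ n₁ n₃ ⟨u, huC, hu⟩
        ⟨x, hx.2, a.symm⟩
    · exact h.no_three_of_triangle hG h₃ h₁ h₂ a₁₃.symm a₂₃.symm a₁₂ hCK hC n₃ n₁ n₂
        ⟨u, huC, hu⟩ ⟨x, hx.2, a.symm⟩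
  · rintro v (rfl | rfl | rfl) <;> assumption

/-- A connected set has at most one neighbor in a triangle of `N`. -/
lemma not_adj_of_triangle (h : Layer G K N R)
    (hG : ¬ IsMinor (completeBipartiteGraph (Fin 2) (Fin 3)) G) {t₁ t₂ t₃ : V} (h₁ : t₁ ∈ N)
    (h₂ : t₂ ∈ N) (h₃ : t₃ ∈ N) (a₁₂ : G.Adj t₁ t₂) (a₁₃ : G.Adj t₁ t₃) (a₂₃ : G.Adj t₂ t₃)
    {C : Set V} (hCK : C ⊆ K) (hC : (G.induce C).Connected) (n₁ : t₁ ∉ C) (n₂ : t₂ ∉ C)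
    (n₃ : t₃ ∉ C) (b₁ : ∃ v ∈ C, G.Adj t₁ v) (b₂ : ∃ v ∈ C, G.Adj t₂ v) : False := by
  refine hG (isMinor_k23 (X := {t₁}) (Y := {t₂}) (L₁ := {t₃}) (L₂ := R) (L₃ := C)
    (connected_induce_singleton _) (connected_induce_singleton _) (connected_induce_singleton _)
    h.conn hC ?_ ?_ ?_ ?_ ?_ ?_ ?_ ?_ ?_ ?_ ?_ ?_ ?_ ?_ ?_ ?_)
  · simpa using a₁₂.ne
  · simpa using a₁₃.ne
  · simpa using h.notMem (h.subset h₁)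
  · simpa using n₁
  · simpa using a₂₃.ne
  · simpa using h.notMem (h.subset h₂)
  · simpa using n₂
  · simpa using h.notMem (h.subset h₃)
  · simpa using n₃
  · exact h.disj.mono_right hCK
  · simpa using a₁₃
  · simpa [G.adj_comm] using h.adj t₁ h₁
  · simpa using b₁
  · simpa using a₂₃
  · simpa [G.adj_comm] using h.adj t₂ h₂
  · simpa using b₂

end Layer

/-- `R` is a connected set that avoids `K`, `p` and `q` and has `p` and `q` among its neighbors. -/
structure Link (G : SimpleGraph V) (K R : Set V) (p q : V) : Prop where
  conn : (G.induce R).Connected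
  disj : Disjoint R K
  left_notMem : p ∉ R
  right_notMem : q ∉ R
  left_adj : ∃ u ∈ R, G.Adj u p
  right_adj : ∃ u ∈ R, G.Adj u q

namespace Link

variable {K R : Set V} {p q : V}

lemma symm (h : Link G K R p q) : Link G K R q p :=
  ⟨h.conn, h.disj, h.right_notMem, h.left_notMem, h.right_adj, h.left_adj⟩

lemma notMem (h : Link G K R p q) {x : V} (hx : x ∈ K) : x ∉ R :=
  fun hR => h.disj.le_bot ⟨hR, hx⟩

lemma conn_insert (h : Link G K R p q) : (G.induce ({q} ∪ R)).Connected := by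
  obtain ⟨u, hu, a⟩ := h.right_adj
  exact connected_induce_union (connected_induce_singleton q).preconnected h.conn.preconnected rfl
    hu a.symm

lemma conn_insert_insert (h : Link G K R p q) : (G.induce ({p} ∪ ({q} ∪ R))).Connected := by
  obtain ⟨u, hu, a⟩ := h.left_adj
  exact connected_induce_union (connected_induce_singleton p).preconnected
    h.conn_insert.preconnected rfl (Or.inr hu) a.symm

/-- Two vertices of `K` cannot both be adjacent to `p` and `q`. -/
lemma eq_of_adj (h : Link G K R p q)
    (hG : ¬ IsMinor (completeBipartiteGraph (Fin 2) (Fin 3)) G) (hpq : p ≠ q) {x y : V}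
    (hx : x ∈ K) (hy : y ∈ K) (hxp : G.Adj x p) (hxq : G.Adj x q)
    (hyp : G.Adj y p) (hyq : G.Adj y q) : x = y := by
  by_contra hxy
  refine hG (isMinor_k23 (X := {p}) (Y := {q}) (L₁ := {x}) (L₂ := {y}) (L₃ := R)
    (connected_induce_singleton _) (connected_induce_singleton _) (connected_induce_singleton _)
    (connected_induce_singleton _) h.conn ?_ ?_ ?_ ?_ ?_ ?_ ?_ ?_ ?_ ?_ ?_ ?_ ?_ ?_ ?_ ?_)
  · simpa using hpq
  · simpa using hxp.ne.symm
  · simpa using hyp.ne.symm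
  · simpa using h.left_notMem
  · simpa using hxq.ne.symm
  · simpa using hyq.ne.symm
  · simpa using h.right_notMem
  · simpa using hxy
  · simpa using h.notMem hx
  · simpa using h.notMem hy
  · simpa using hxp.symm
  · simpa using hyp.symm
  · simpa [G.adj_comm] using h.left_adj
  · simpa using hxq.symm
  · simpa using hyq.symm
  · simpa [G.adj_comm] using h.right_adj

/-- If two vertices of a triangle in `K` are adjacent to `p`, then the third one is not adjacent
to `q`. -/
lemma not_adj_of_triangle (h : Link G K R p q)
    (hG : ¬ IsMinor (completeBipartiteGraph (Fin 2) (Fin 3)) G) (hpq : p ≠ q) (hp : p ∉ K)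
    (hq : q ∉ K) {t₁ t₂ t₃ : V} (h₁ : t₁ ∈ K) (h₂ : t₂ ∈ K) (h₃ : t₃ ∈ K) (a₁₂ : G.Adj t₁ t₂)
    (a₁₃ : G.Adj t₁ t₃) (a₂₃ : G.Adj t₂ t₃) (b₁ : G.Adj t₁ p) (b₂ : G.Adj t₂ p) :
    ¬ G.Adj t₃ q := by
  intro b₃
  have hKq : ∀ t ∈ K, t ≠ q := fun t ht e => hq (e ▸ ht)
  have hKp : ∀ t ∈ K, t ≠ p := fun t ht e => hp (e ▸ ht)
  refine hG (isMinor_k23 (X := {t₃}) (Y := {p}) (L₁ := {t₁}) (L₂ := {t₂}) (L₃ := {q} ∪ R)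
    (connected_induce_singleton _) (connected_induce_singleton _) (connected_induce_singleton _)
    (connected_induce_singleton _) h.conn_insert
    ?_ ?_ ?_ ?_ ?_ ?_ ?_ ?_ ?_ ?_ ?_ ?_ ?_ ?_ ?_ ?_)
  · simpa using hKp t₃ h₃
  · simpa using a₁₃.ne.symm
  · simpa using a₂₃.ne.symm
  · simpa using ⟨hKq t₃ h₃, h.notMem h₃⟩
  · simpa using (hKp t₁ h₁).symm
  · simpa using (hKp t₂ h₂).symm
  · simpa using ⟨hpq, h.left_notMem⟩
  · simpa using a₁₂.ne
  · simpa using ⟨hKq t₁ h₁, h.notMem h₁⟩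
  · simpa using ⟨hKq t₂ h₂, h.notMem h₂⟩
  · simpa using a₁₃.symm
  · simpa using a₂₃.symm
  · exact ⟨t₃, rfl, q, Or.inl rfl, b₃⟩
  · simpa using b₁.symm
  · simpa using b₂.symm
  · obtain ⟨u, hu, a⟩ := h.left_adj
    exact ⟨p, rfl, u, Or.inr hu, a.symm⟩

/-- The neighbors in `{p, q}` of the vertices of a triangle in `K` are all equal. -/
lemma exists_parent (h : Link G K R p q)
    (hG : ¬ IsMinor (completeBipartiteGraph (Fin 2) (Fin 3)) G) (hpq : p ≠ q) (hp : p ∉ K)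
    (hq : q ∉ K) {t₁ t₂ t₃ : V} (h₁ : t₁ ∈ K) (h₂ : t₂ ∈ K) (h₃ : t₃ ∈ K) (a₁₂ : G.Adj t₁ t₂)
    (a₁₃ : G.Adj t₁ t₃) (a₂₃ : G.Adj t₂ t₃) (b₁ : G.Adj t₁ p ∨ G.Adj t₁ q)
    (b₂ : G.Adj t₂ p ∨ G.Adj t₂ q) (b₃ : G.Adj t₃ p ∨ G.Adj t₃ q) :
    (¬ G.Adj t₁ p ∧ ¬ G.Adj t₂ p ∧ ¬ G.Adj t₃ p) ∨
      (¬ G.Adj t₁ q ∧ ¬ G.Adj t₂ q ∧ ¬ G.Adj t₃ q) := by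
  have c₁ := h.not_adj_of_triangle hG hpq hp hq h₁ h₂ h₃ a₁₂ a₁₃ a₂₃
  have c₂ := h.not_adj_of_triangle hG hpq hp hq h₁ h₃ h₂ a₁₃ a₁₂ a₂₃.symm
  have c₃ := h.not_adj_of_triangle hG hpq hp hq h₂ h₃ h₁ a₂₃ a₁₂.symm a₁₃.symm
  have d₁ := h.symm.not_adj_of_triangle hG hpq.symm hq hp h₁ h₂ h₃ a₁₂ a₁₃ a₂₃
  have d₂ := h.symm.not_adj_of_triangle hG hpq.symm hq hp h₁ h₃ h₂ a₁₃ a₁₂ a₂₃.symm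
  have d₃ := h.symm.not_adj_of_triangle hG hpq.symm hq hp h₂ h₃ h₁ a₂₃ a₁₂.symm a₁₃.symm
  clear h hG hpq hp hq h₁ h₂ h₃ a₁₂ a₁₃ a₂₃
  grind

end Link

end Structure

section Induction

variable {V : Type} {G : SimpleGraph V} {U N K : Set V} {p q : V} {c : V → Fin 5}
  {T : V × Fin 5 → Prop} {κ : V → ℕ} {l l' : List (V × Fin 5)}

/-- The three ways in which the moves of `l` may be harmless for vertices whose neighbors that
have already been treated are among `p` and `q`. -/
def Status (c : V → Fin 5) (l : List (V × Fin 5)) (p q : V) : Prop :=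
  cnt₂ p q l ≤ 40 ∨
    (∃ l₁ l₂, l = l₁ ++ l₂ ∧ PathBag.PreB c l₁ l₂ p ∧ PathBag.PreB c l₁ l₂ q) ∨
    ∃ l₁ l₂ l₃, l = l₁ ++ l₂ ++ l₃ ∧ PathBag.PreC c l₁ l₂ l₃ p ∧ PathBag.PreC c l₁ l₂ l₃ q

lemma PathBag.PreB.of_filter {l₁ l₂ : List (V × Fin 5)} (hp : p ∈ U)
    (h : PathBag.PreB c (l₁.filter fun m => m.1 ∈ U) (l₂.filter fun m => m.1 ∈ U) p) :
    PathBag.PreB c l₁ l₂ p where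
  cnt₁ := cnt_filter hp l₁ ▸ h.cnt₁
  cnt₂ := cnt_filter hp l₂ ▸ h.cnt₂
  run_ne := run_eq_of_filter c c l₁ (fun _ _ => rfl) p hp ▸ h.run_ne
  ne m hm e := h.ne m (List.mem_filter.2 ⟨hm, by simpa [e] using hp⟩) e

lemma PathBag.PreC.of_filter {l₁ l₂ l₃ : List (V × Fin 5)} (hp : p ∈ U)
    (h : PathBag.PreC c (l₁.filter fun m => m.1 ∈ U) (l₂.filter fun m => m.1 ∈ U)
      (l₃.filter fun m => m.1 ∈ U) p) : PathBag.PreC c l₁ l₂ l₃ p where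
  cnt₁ := cnt_filter hp l₁ ▸ h.cnt₁
  cnt₃ := cnt_filter hp l₃ ▸ h.cnt₃
  mid := by
    have hm : ∀ m ∈ l₂, m.1 = p → m ∈ l₂.filter fun m => m.1 ∈ U := fun m hm e =>
      List.mem_filter.2 ⟨hm, by simpa [e] using hp⟩
    rw [run_eq_of_filter c c l₁ (fun _ _ => rfl) p hp]
    exact h.mid.imp (fun h => ⟨h.1, fun m hm' e => h.2 m (hm m hm' e) e⟩)
      fun h => ⟨h.1, fun m hm' e => h.2 m (hm m hm' e) e⟩

lemma Ext.cnt_eq (h : Ext G U N T κ c l l') {v : V} (hv : v ∈ U) : cnt v l' = cnt v l := by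
  rw [← cnt_filter hv l', h.filter_eq]

lemma Status.ext (hE : Ext G U N T κ c l l') (hp : p ∈ U) (hq : q ∈ U) (h : Status c l p q) :
    Status c l' p q := by
  have hf := hE.filter_eq
  rcases h with h | ⟨l₁, l₂, rfl, h₁, h₂⟩ | ⟨l₁, l₂, l₃, rfl, h₁, h₂⟩
  · refine Or.inl (le_of_eq_of_le ?_ h)
    rw [← hf, cnt₂, cnt₂, List.countP_filter]
    refine List.countP_congr fun m _ => ?_
    simp only [decide_eq_true_eq, Bool.and_eq_true]
    exact ⟨fun h => ⟨h, by rcases h with h | h <;> rwa [h]⟩, fun h => h.1⟩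
  · obtain ⟨k₁, k₂, rfl, rfl, rfl⟩ := List.filter_eq_append_iff.1 hf
    exact Or.inr (Or.inl ⟨k₁, k₂, rfl, h₁.of_filter hp, h₂.of_filter hq⟩)
  · obtain ⟨k, k₃, rfl, hk, rfl⟩ := List.filter_eq_append_iff.1 hf
    obtain ⟨k₁, k₂, rfl, rfl, rfl⟩ := List.filter_eq_append_iff.1 hk
    exact Or.inr (Or.inr ⟨k₁, k₂, k₃, rfl, h₁.of_filter hp, h₂.of_filter hq⟩)

lemma PathBag.exists_ext_status [Finite V] {A B : Set V} {z : V} {par : V → V}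
    (h : PathBag G U A B z p q par) (hl : Valid G U c l) (hs : Status c l p q) :
    ∃ l', Ext G U (A ∪ B) (fun _ => True) (fun _ => 48) c l l' ∧
      (∀ v ∈ A ∪ B, run c l' v ≠ 4) ∧ ∀ s ∈ A ∪ B, ∀ t ∈ A ∪ B, Status c l' s t := by
  rcases hs with hs | ⟨l₁, l₂, rfl, hp, hq⟩ | ⟨l₁, l₂, l₃, rfl, hp, hq⟩
  · obtain ⟨l₁, l₂, hE, hc⟩ := h.exists_ext_of_cnt₂_le hl hs
    exact ⟨_, hE, fun v hv => (hc v hv).1, fun s hs t ht =>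
      Or.inr (Or.inl ⟨l₁, l₂, rfl, (hc s hs).2, (hc t ht).2⟩)⟩
  · obtain ⟨k₁, k₂, k₃, hE, hc⟩ := h.exists_ext_of_preB hl hp hq
    exact ⟨_, hE, fun v hv => (hc v hv).1, fun s hs t ht =>
      Or.inr (Or.inr ⟨k₁, k₂, k₃, rfl, (hc s hs).2, (hc t ht).2⟩)⟩
  · obtain ⟨k, hE, hc⟩ := h.exists_ext_of_preC hl hp hq
    refine ⟨k, hE.mono (fun _ _ h => h) fun _ _ => by norm_num, hc, fun s hs t ht => Or.inl ?_⟩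
    have h₁ := hE.cnt_le s hs
    have h₂ := hE.cnt_le t ht
    have := cnt₂_le s t k
    omega

/-- The neighbors of `K` in `U` are among two vertices that are linked outside `K`, and the moves
of `l` are harmless for `K`. -/
def Good (G : SimpleGraph V) (U K : Set V) (c : V → Fin 5) (l : List (V × Fin 5)) : Prop :=
  (∀ x ∈ K, ∀ u ∈ U, ¬ G.Adj x u) ∨
    ∃ p ∈ U, ∃ q ∈ U, (∀ x ∈ K, ∀ u ∈ U, G.Adj x u → u = p ∨ u = q) ∧
      (p ≠ q → ∃ R, Link G K R p q) ∧ Status c l p q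

/-- If `K` has no neighbor in `N`, then it remains good when `N` is added to `U`. -/
lemma Good.ext (hE : Ext G U N T κ c l l') (hN : ∀ x ∈ K, ∀ u ∈ N, ¬ G.Adj x u)
    (h : Good G U K c l) : Good G (U ∪ N) K c l' := by
  rcases h with h | ⟨p, hp, q, hq, h₁, h₂, h₃⟩
  · exact Or.inl fun x hx u hu => hu.elim (h x hx u) (hN x hx u)
  · exact Or.inr ⟨p, Or.inl hp, q, Or.inl hq, fun x hx u hu a =>
      hu.elim (fun hu => h₁ x hx u hu a) fun hu => absurd a (hN x hx u hu), h₂, h₃.ext hE hp hq⟩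

lemma Valid.union (h : Valid G U c l) (hN : ∀ x ∈ U, ∀ u ∈ N, ¬ G.Adj x u) :
    Valid G (U ∪ N) c l := by
  induction l generalizing c with
  | nil => trivial
  | cons m l ih =>
    exact ⟨Or.inl h.1, fun w hw a => hw.elim (fun hw => h.2.1 w hw a)
      fun hw => absurd a (hN _ h.1 w hw), ih h.2.2⟩

/-- A vertex without neighbors in `U` may be added to `U`. -/
lemma exists_ext_of_no_neighbor {v : V} (hv : v ∈ K) (hvU : v ∉ U)
    (hK : ∀ x ∈ K, ∀ u ∈ U, ¬ G.Adj x u) (hl : Valid G U c l) :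
    ∃ l', Ext G U {v} (fun _ => True) (fun _ => 48) c l l' ∧
      (∀ w ∈ ({v} : Set V), run c l' w ≠ 4) ∧ ∀ C ⊆ K, Good G (U ∪ {v}) C c l' := by
  have h0 : cnt v l = 0 := cnt_eq_zero.2 fun m hm e => hvU (e ▸ hl.mem m hm)
  have hcnt : cnt v (l ++ [(v, 0)]) = 1 := by simp [h0, cnt_cons]
  refine ⟨l ++ [(v, 0)], ⟨?_, ?_, fun _ _ _ => trivial, ?_⟩, ?_, fun C hC => Or.inr
    ⟨v, Or.inr rfl, v, Or.inr rfl, fun x hx u hu a => ?_, fun h => absurd rfl h, Or.inl ?_⟩⟩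
  · refine (valid_append ..).2 ⟨hl.union ?_, Or.inr rfl, ?_, trivial⟩
    · rintro x hx _ rfl a
      exact hK _ hv x hx a.symm
    · rintro w (hw | rfl) a
      · exact absurd a (hK v hv w hw)
      · exact absurd rfl a.ne
  · rw [List.filter_append, List.filter_eq_self.2 fun m hm => by simpa using hl.mem m hm]
    simp [hvU]
  · rintro _ rfl
    omega
  · rintro _ rfl
    simp [run_append]
  · exact hu.elim (fun hu => absurd a (hK x (hC hx) u hu)) Or.inl
  · rw [cnt₂_self, hcnt]
    norm_num

/-- The vertices of `K` with a neighbor in `U`. -/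
def boundary (G : SimpleGraph V) (U K : Set V) : Set V := {v | v ∈ K ∧ ∃ u ∈ U, G.Adj v u}

lemma boundary_subset : boundary G U K ⊆ K := fun _ h => h.1

lemma mem_boundary_of_adj {C : Set V} (hC : C ⊆ K \ boundary G U K) {x u : V} (hx : x ∈ C)
    (hu : u ∈ U ∪ boundary G U K) (a : G.Adj x u) : u ∈ boundary G U K :=
  hu.resolve_left fun hu => (hC hx).2 ⟨(hC hx).1, u, hu, a⟩

/-- Everything outside the boundary of a layer is good if its vertices are harmless. -/
lemma Layer.good {R C : Set V} (h : Layer G K (boundary G U K) R)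
    (hG : ¬ IsMinor (completeBipartiteGraph (Fin 2) (Fin 3)) G) (hC : C ⊆ K \ boundary G U K)
    (hCc : (G.induce C).Connected)
    (hs : ∀ s ∈ boundary G U K, ∀ t ∈ boundary G U K, (∃ x ∈ C, G.Adj x s) →
      (∃ x ∈ C, G.Adj x t) → Status c l s t) : Good G (U ∪ boundary G U K) C c l := by
  have hnC : ∀ x ∈ boundary G U K, x ∉ C := fun x hx hxC => (hC hxC).2 hx
  rcases exists_pair_of_no_three (S := fun s => s ∈ boundary G U K ∧ ∃ x ∈ C, G.Adj x s)
    (fun x y z hx hy hz => h.no_three_attachments hG (hC.trans Set.sdiff_subset) hCc x y z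
      ⟨hx.1, hnC x hx.1, hx.2⟩ ⟨hy.1, hnC y hy.1, hy.2⟩ ⟨hz.1, hnC z hz.1, hz.2⟩)
    with h0 | ⟨s, t, hs', ht', hst⟩
  · exact Or.inl fun x hx u hu a => h0 u ⟨mem_boundary_of_adj hC hx hu a, x, hx, a⟩
  · refine Or.inr ⟨s, Or.inr hs'.1, t, Or.inr ht'.1,
      fun x hx u hu a => hst u ⟨mem_boundary_of_adj hC hx hu a, x, hx, a⟩, fun _ => ⟨R, h.conn,
        h.disj.mono_right (hC.trans Set.sdiff_subset), h.notMem (boundary_subset hs'.1),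
        h.notMem (boundary_subset ht'.1), h.adj s hs'.1, h.adj t ht'.1⟩,
      hs s hs'.1 t ht'.1 hs'.2 ht'.2⟩

lemma exists_ext_of_triangle {R : Set V} (h : Layer G K (boundary G U K) R)
    (hG : ¬ IsMinor (completeBipartiteGraph (Fin 2) (Fin 3)) G) (hKU : Disjoint U K)
    (hK : (G.induce K).Connected) (hc : IsProperColoring G c) (hl : Valid G U c l)
    {t₁ t₂ t₃ : V} (h₁ : t₁ ∈ boundary G U K) (h₂ : t₂ ∈ boundary G U K)
    (h₃ : t₃ ∈ boundary G U K) (a₁₂ : G.Adj t₁ t₂) (a₁₃ : G.Adj t₁ t₃) (a₂₃ : G.Adj t₂ t₃)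
    (hp : p ∈ U) (hub : ∀ v ∈ boundary G U K, ∀ u ∈ U, G.Adj v u → u = p)
    (hcnt : cnt p l ≤ 48) :
    ∃ l', Ext G U (boundary G U K) (fun _ => True) (fun _ => 48) c l l' ∧
      (∀ v ∈ boundary G U K, run c l' v ≠ 4) ∧
      ∀ C ⊆ K \ boundary G U K, (G.induce C).Connected →
        Good G (U ∪ boundary G U K) C c l' := by
  have hN := h.eq_of_triangle hG hK h₁ h₂ h₃ a₁₂ a₁₃ a₂₃
  have hT : TriangleBag G U (boundary G U K) p t₁ t₂ t₃ :=
    ⟨hKU.mono_right boundary_subset, hp, hN, a₁₂.ne, a₁₃.ne, a₂₃.ne, hub⟩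
  have hr : Rainbow (boundary G U K) p c := by
    refine ⟨?_, fun v hv => ?_⟩
    · rw [hN]
      rintro v (rfl | rfl | rfl) w (rfl | rfl | rfl) hvw
      exacts [absurd rfl hvw, hc a₁₂, hc a₁₃, hc a₁₂.symm, absurd rfl hvw, hc a₂₃, hc a₁₃.symm,
        hc a₂₃.symm, absurd rfl hvw]
    · obtain ⟨u, hu, a⟩ := hv.2
      exact hub v hv u hu a ▸ hc a
  obtain ⟨l', hE, hne⟩ := hT.exists_ext hr hl hcnt
  refine ⟨l', hE.mono (fun _ _ h => h) fun _ _ => by norm_num, hne, fun C hC hCc =>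
    h.good hG hC hCc fun s hs t ht hs' ht' => Or.inl ?_⟩
  have hst : s = t := by
    have hCK := hC.trans Set.sdiff_subset
    have hn : ∀ x ∈ boundary G U K, x ∉ C := fun x hx hxC => (hC hxC).2 hx
    have n₁ := hn t₁ h₁
    have n₂ := hn t₂ h₂
    have n₃ := hn t₃ h₃
    simp only [G.adj_comm _ s, G.adj_comm _ t] at hs' ht'
    have k₁₂ := h.not_adj_of_triangle hG h₁ h₂ h₃ a₁₂ a₁₃ a₂₃ hCK hCc n₁ n₂ n₃
    have k₁₃ := h.not_adj_of_triangle hG h₁ h₃ h₂ a₁₃ a₁₂ a₂₃.symm hCK hCc n₁ n₃ n₂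
    have k₂₃ := h.not_adj_of_triangle hG h₂ h₃ h₁ a₂₃ a₁₂.symm a₁₃.symm hCK hCc n₂ n₃ n₁
    rw [hN] at hs ht
    rcases hs with rfl | rfl | rfl <;> rcases ht with rfl | rfl | rfl
    exacts [rfl, (k₁₂ hs' ht').elim, (k₁₃ hs' ht').elim, (k₁₂ ht' hs').elim, rfl,
      (k₂₃ hs' ht').elim, (k₁₃ ht' hs').elim, (k₂₃ ht' hs').elim, rfl]
  subst hst
  rw [cnt₂_self]
  exact hE.cnt_le s hs

lemma exists_ext_of_bipartite [Finite V] {R : Set V} (h : Layer G K (boundary G U K) R)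
    (hG : ¬ IsMinor (completeBipartiteGraph (Fin 2) (Fin 3)) G) (hKU : Disjoint U K)
    (hl : Valid G U c l) (f : V → Fin 2)
    (hf : ∀ u ∈ boundary G U K, ∀ v ∈ boundary G U K, G.Adj u v → f u ≠ f v)
    (hp : p ∈ U) (hq : q ∈ U) (hub : ∀ x ∈ K, ∀ u ∈ U, G.Adj x u → u = p ∨ u = q)
    (hpq : p ≠ q → ∃ R, Link G K R p q) (hs : Status c l p q) :
    ∃ l', Ext G U (boundary G U K) (fun _ => True) (fun _ => 48) c l l' ∧
      (∀ v ∈ boundary G U K, run c l' v ≠ 4) ∧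
      ∀ C ⊆ K \ boundary G U K, (G.induce C).Connected →
        Good G (U ∪ boundary G U K) C c l' := by
  obtain ⟨z, hz⟩ : ∃ z, p ≠ q → ∀ v ∈ K, G.Adj v p → G.Adj v q → v = z := by
    by_cases hex : ∃ z ∈ K, G.Adj z p ∧ G.Adj z q
    · obtain ⟨z, hzK, hzp, hzq⟩ := hex
      refine ⟨z, fun hne v hv hvp hvq => ?_⟩
      obtain ⟨R, hR⟩ := hpq hne
      exact hR.eq_of_adj hG hne hv hzK hvp hvq hzp hzq
    · exact ⟨p, fun _ v hv hvp hvq => absurd ⟨v, hv, hvp, hvq⟩ hex⟩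
  set N := boundary G U K with hN
  have hAB : {v | v ∈ N ∧ f v ≠ f z} ∪ {v | v ∈ N ∧ f v = f z} = N := by
    ext v
    exact ⟨fun h => h.elim And.left And.left, fun h => (em (f v = f z)).elim
      (fun e => Or.inr ⟨h, e⟩) fun e => Or.inl ⟨h, e⟩⟩
  have hbag : PathBag G U {v | v ∈ N ∧ f v ≠ f z} {v | v ∈ N ∧ f v = f z} z p q
      (fun v => if G.Adj v q then q else p) := by
    refine ⟨?_, ?_, ?_, ?_, fun h => h.2 rfl, hp, hq, fun v => ?_, ?_, ?_, ?_⟩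
    · rw [hAB]
      exact hKU.mono_right boundary_subset
    · exact Set.disjoint_left.2 fun v hv hv' => hv.2 hv'.2
    · intro v hv w hw a
      have h1 := hf v hv.1 w hw.1 a
      have h2 := hv.2
      have h3 := hw.2
      omega
    · exact fun v hv w hw a => hf v hv.1 w hw.1 a (hv.2.trans hw.2.symm)
    · split_ifs
      exacts [Or.inr rfl, Or.inl rfl]
    · rw [hAB]
      intro v hv hvz u hu a
      split_ifs with hvq
      · refine (hub v hv.1 u hu a).elim (fun e => ?_) id
        subst e
        by_contra hne
        exact hvz (hz hne v hv.1 a hvq)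
      · exact (hub v hv.1 u hu a).resolve_right fun e => hvq (e ▸ a)
    · rw [hAB]
      exact fun v hv => hub v hv.1
    · intro v hv
      rcases exists_pair_of_no_three (S := fun w => w ∈ N ∧ G.Adj v w)
        (h.no_three_neighbors hG hv.1) with h0 | ⟨s₁, s₂, -, -, h0⟩
      · exact ⟨v, v, fun w hw a => absurd ⟨hw.1, a⟩ (h0 w)⟩
      · exact ⟨s₁, s₂, fun w hw a => h0 w ⟨hw.1, a⟩⟩
  obtain ⟨l', hE, hne, hst⟩ := hbag.exists_ext_status hl hs
  rw [hAB] at hE hne hst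
  exact ⟨l', hE, hne, fun C hC hCc => h.good hG hC hCc fun s hs t ht _ _ => hst s hs t ht⟩

/-- Some nonempty part of a good connected set can be added to `U`. -/
lemma Good.exists_ext [Finite V] (hG : ¬ IsMinor (completeBipartiteGraph (Fin 2) (Fin 3)) G)
    (hKU : Disjoint U K) (hK : (G.induce K).Connected) (hc : IsProperColoring G c)
    (hl : Valid G U c l) (hcnt : ∀ v ∈ U, cnt v l ≤ 48) (h : Good G U K c l) :
    ∃ N ⊆ K, N.Nonempty ∧ ∃ l', Ext G U N (fun _ => True) (fun _ => 48) c l l' ∧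
      (∀ v ∈ N, run c l' v ≠ 4) ∧
      ∀ C ⊆ K \ N, (G.induce C).Connected → Good G (U ∪ N) C c l' := by
  by_cases h0 : ∀ x ∈ K, ∀ u ∈ U, ¬ G.Adj x u
  · obtain ⟨v, hv⟩ := hK.nonempty
    obtain ⟨l', hE, hne, hgood⟩ := exists_ext_of_no_neighbor hv
      (fun hU => hKU.le_bot ⟨hU, hv⟩) h0 hl
    exact ⟨{v}, Set.singleton_subset_iff.2 hv, Set.singleton_nonempty v, l', hE, hne,
      fun C hC _ => hgood C (hC.trans Set.sdiff_subset)⟩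
  obtain ⟨p, hp, q, hq, hub, hpq, hs⟩ := h.resolve_left h0
  have hpK : p ∉ K := fun h => hKU.le_bot ⟨hp, h⟩
  have hqK : q ∉ K := fun h => hKU.le_bot ⟨hq, h⟩
  push Not at h0
  obtain ⟨x, hx, u, hu, a⟩ := h0
  obtain ⟨R, hRc, hRK, hpR, hqR⟩ : ∃ R : Set V, (G.induce R).Connected ∧ Disjoint R K ∧
      p ∈ R ∧ q ∈ R := by
    by_cases hne : p = q
    · exact ⟨{p}, connected_induce_singleton p, Set.disjoint_singleton_left.2 hpK, rfl, hne.symm⟩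
    · obtain ⟨R, hR⟩ := hpq hne
      exact ⟨{p} ∪ ({q} ∪ R), hR.conn_insert_insert, by simp [hpK, hqK, hR.disj], Or.inl rfl,
        Or.inr (Or.inl rfl)⟩
  have hL : Layer G K (boundary G U K) R := ⟨boundary_subset, hRK, hRc, fun v hv => by
    obtain ⟨u, hu, a⟩ := hv.2
    rcases hub v hv.1 u hu a with rfl | rfl
    exacts [⟨u, hpR, a.symm⟩, ⟨u, hqR, a.symm⟩]⟩
  refine ⟨boundary G U K, boundary_subset, ⟨x, hx, u, hu, a⟩, ?_⟩
  rcases hL.exists_triangle_or_bipartite hG with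
    ⟨t₁, h₁, t₂, h₂, t₃, h₃, a₁₂, a₁₃, a₂₃⟩ | ⟨f, hf⟩
  · obtain ⟨r, hr, hr'⟩ : ∃ r ∈ U, ∀ v ∈ boundary G U K, ∀ u ∈ U, G.Adj v u → u = r := by
      by_cases hne : p = q
      · exact ⟨p, hp, fun v hv u hu a => (hub v hv.1 u hu a).elim id fun e => e.trans hne.symm⟩
      obtain ⟨R', hR'⟩ := hpq hne
      have hb : ∀ t ∈ boundary G U K, G.Adj t p ∨ G.Adj t q := by
        intro t ht
        obtain ⟨u, hu, a⟩ := ht.2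
        rcases hub t ht.1 u hu a with rfl | rfl
        exacts [Or.inl a, Or.inr a]
      have := hR'.exists_parent hG hne hpK hqK h₁.1 h₂.1 h₃.1 a₁₂ a₁₃ a₂₃ (hb t₁ h₁) (hb t₂ h₂)
        (hb t₃ h₃)
      rw [hL.eq_of_triangle hG hK h₁ h₂ h₃ a₁₂ a₁₃ a₂₃]
      rcases this with ⟨n₁, n₂, n₃⟩ | ⟨n₁, n₂, n₃⟩
      · refine ⟨q, hq, ?_⟩
        rintro v (rfl | rfl | rfl) u hu a
        · exact (hub _ h₁.1 u hu a).resolve_left fun e => n₁ (e ▸ a)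
        · exact (hub _ h₂.1 u hu a).resolve_left fun e => n₂ (e ▸ a)
        · exact (hub _ h₃.1 u hu a).resolve_left fun e => n₃ (e ▸ a)
      · refine ⟨p, hp, ?_⟩
        rintro v (rfl | rfl | rfl) u hu a
        · exact (hub _ h₁.1 u hu a).resolve_right fun e => n₁ (e ▸ a)
        · exact (hub _ h₂.1 u hu a).resolve_right fun e => n₂ (e ▸ a)
        · exact (hub _ h₃.1 u hu a).resolve_right fun e => n₃ (e ▸ a)
    exact exists_ext_of_triangle hL hG hKU hK hc hl h₁ h₂ h₃ a₁₂ a₁₃ a₂₃ hr hr' (hcnt r hr)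
  · exact exists_ext_of_bipartite hL hG hKU hl f hf hp hq hub hpq hs

/-- The moves of `l` remove color `4` from `U`, and the rest of the graph can still be treated. -/
structure Partial (G : SimpleGraph V) (U : Set V) (c : V → Fin 5) (l : List (V × Fin 5)) :
    Prop where
  valid : Valid G U c l
  ne : ∀ v ∈ U, run c l v ≠ 4
  cnt_le : ∀ v ∈ U, cnt v l ≤ 48
  good : ∀ C ⊆ Uᶜ, (G.induce C).Connected → Good G U C c l

lemma Partial.exists_ssuperset [Finite V]
    (hG : ¬ IsMinor (completeBipartiteGraph (Fin 2) (Fin 3)) G) (hc : IsProperColoring G c)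
    (h : Partial G U c l) (hU : U ≠ Set.univ) : ∃ W l', U ⊂ W ∧ Partial G W c l' := by
  obtain ⟨v, hv⟩ := (Set.ne_univ_iff_exists_notMem U).1 hU
  have hv : v ∈ Uᶜ := hv
  have hKU := component_subset (G := G) (W := Uᶜ) (v := v)
  have hK := connected_component (G := G) hv
  have hd : Disjoint U (component G Uᶜ v) := Set.subset_compl_iff_disjoint_left.1 hKU
  obtain ⟨N, hNK, hN, l', hE, hne, hgood⟩ :=
    (h.good _ hKU hK).exists_ext hG hd hK hc h.valid h.cnt_le
  refine ⟨U ∪ N, l', ?_, hE.valid, ?_, ?_, fun C hC hCc => ?_⟩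
  · obtain ⟨x, hx⟩ := hN
    exact ⟨Set.subset_union_left, fun hs => hKU (hNK hx) (hs (Or.inr hx))⟩
  · rintro w (hw | hw)
    · rw [hE.run_eq w hw]
      exact h.ne w hw
    · exact hne w hw
  · rintro w (hw | hw)
    · rw [hE.cnt_eq hw]
      exact h.cnt_le w hw
    · exact hE.cnt_le w hw
  · have hCU : C ⊆ Uᶜ := hC.trans (Set.compl_subset_compl.2 Set.subset_union_left)
    by_cases hCK : ∃ x ∈ C, x ∈ component G Uᶜ v
    · obtain ⟨x, hx, hxK⟩ := hCK
      exact hgood C (fun y hy => ⟨subset_component_of_mem hv hCU hCc hx hxK hy,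
        fun hyN => hC hy (Or.inr hyN)⟩) hCc
    · exact (h.good C hCU hCc).ext hE fun x hx u hu a =>
        hCK ⟨x, hx, mem_component_of_adj hv (hNK hu) (hCU hx) a.symm⟩

lemma Partial.exists_univ [Finite V]
    (hG : ¬ IsMinor (completeBipartiteGraph (Fin 2) (Fin 3)) G) (hc : IsProperColoring G c) :
    ∃ l, Partial G Set.univ c l := by
  have h0 : Partial G ∅ c [] :=
    ⟨trivial, by simp, by simp, fun C _ _ => Or.inl fun _ _ _ hu => hu.elim⟩
  obtain ⟨U, hU⟩ := (Set.toFinite {U | ∃ l, Partial G U c l}).exists_maximal ⟨∅, [], h0⟩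
  obtain ⟨l, hl⟩ := hU.prop
  by_contra hcon
  obtain ⟨W, l', hUW, hW⟩ := hl.exists_ssuperset hG hc fun e => hcon ⟨l, e ▸ hl⟩
  exact hUW.not_subset (hU.le_of_ge ⟨l', hW⟩ hUW.subset)

end Induction

end Recoloring

theorem k23_minor_free_transform_to_four_coloring
    {V : Type} [Fintype V] (H : SimpleGraph V)
    (h23 : ¬ IsMinor (completeBipartiteGraph (Fin 2) (Fin 3)) H)
    (α : V → Fin 5) (hα : IsProperColoring H α) :
    ∃ β : V → Fin 5, IsProperColoring H β ∧
      (∃ S : Finset (Fin 5), S.card = 4 ∧ ∀ v : V, β v ∈ S) ∧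
      ∃ (m : ℕ) (c : Fin (m + 1) → V → Fin 5),
        IsTransformSeq H c α β ∧ ∀ v : V, RecolorCount c v ≤ 692 := by
  obtain ⟨l, hl⟩ := Recoloring.Partial.exists_univ h23 hα
  obtain ⟨hβ, m, s, hs, hcount⟩ := Recoloring.exists_isTransformSeq α hα l hl.valid
  refine ⟨Recoloring.run α l, hβ, ⟨Finset.univ.erase 4, rfl, fun v => ?_⟩, m, s, hs, fun v => ?_⟩
  · simpa using hl.ne v trivial
  · have := hcount v
    have := hl.cnt_le v trivial
    omega
end

section
/- Let h = 692, let H be the complete graph K_4 on vertices v_1, v_2, v_3, v_4, let q ≤ h be a nonnegative integer, and let c_0, c_1, …, c_q be a prescribed sequence of colors for v_4 with c_i ≠ c_{i+1} for each i. Then for every pair of proper 5-colorings α' and β' of H with α'(v_4) = c_0 and β'(v_4) = c_q, there exists a transformation from α' to β' in which v_4 follows the prescribed coloring order c_0, …, c_q, each vertex is recolored at most h times, and each of the vertices v_1, v_2, v_3 is recolored at most h − 3 = 689 times. -/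
open SimpleGraph

/-- Every edge of `G` lies on at most one cycle: two cycles sharing an edge have the
same edge set. -/
def EdgeOnAtMostOneCycle {V : Type} (G : SimpleGraph V) : Prop :=
  ∀ (u v : V) (p : G.Walk u u) (q : G.Walk v v), p.IsCycle → q.IsCycle →
    ∀ e, e ∈ p.edges → e ∈ q.edges → ∀ e', (e' ∈ p.edges ↔ e' ∈ q.edges)

/-- A cactus graph: connected and every edge lies on at most one cycle. -/
def IsCactus {V : Type} (G : SimpleGraph V) : Prop :=
  G.Connected ∧ EdgeOnAtMostOneCycle G

/-- A chordal graph: every cycle of length at least `4` has a chord; equivalently,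
there is no induced cycle of length at least `4`. -/
def IsChordal {V : Type} (G : SimpleGraph V) : Prop :=
  ∀ (v : V) (p : G.Walk v v), p.IsCycle → 4 ≤ p.length →
    ∃ u w, u ∈ p.support ∧ w ∈ p.support ∧ G.Adj u w ∧ s(u, w) ∉ p.edges

/-- The sequence of successive colors taken by the vertex `v` along the sequence `c`
(its starting color followed by the new color at each of its recolorings). -/
def ColorTrace {V : Type} {ℓ m : ℕ} (c : Fin (m + 1) → V → Fin ℓ) (v : V) : List (Fin ℓ) :=
  (List.ofFn fun i : Fin (m + 1) => c i v).destutter (· ≠ ·)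

/-- `Recolors α β k L`: the coloring `α` of `K₄` can be turned into `β` by successively recoloring
a vertex with the unused color, recoloring each vertex `v` exactly `k v` times, where `L` lists
the successive new colors of the vertex `3`. -/
inductive Recolors : (Fin 4 → Fin 5) → (Fin 4 → Fin 5) → (Fin 4 → ℕ) → List (Fin 5) → Prop
  | refl (α : Fin 4 → Fin 5) : Recolors α α 0 []
  | step {α β : Fin 4 → Fin 5} {k : Fin 4 → ℕ} {L : List (Fin 5)} (v : Fin 4) (x : Fin 5)
      (hx : ∀ u, α u ≠ x) (h : Recolors (Function.update α v x) β k L) :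
      Recolors α β (k + Pi.single v 1) (if v = 3 then x :: L else L)

theorem isProperColoring_top_iff_injective {ℓ : ℕ} {c : Fin 4 → Fin ℓ} :
    IsProperColoring (⊤ : SimpleGraph (Fin 4)) c ↔ Function.Injective c := by
  constructor
  · intro h u v huv
    by_contra hne
    exact h ((SimpleGraph.top_adj u v).2 hne) huv
  · intro h u v huv he
    exact (SimpleGraph.top_adj u v).1 huv (h he)

theorem injective_update_of_unused {α : Fin 4 → Fin 5} (hα : Function.Injective α) (v : Fin 4)
    {x : Fin 5} (hx : ∀ u, α u ≠ x) : Function.Injective (Function.update α v x) := by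
  intro a b hab
  have := @hα a b
  have := hx a
  have := hx b
  simp only [Function.update_apply] at hab
  grind

theorem exists_unused_color (α : Fin 4 → Fin 5) : ∃ f, ∀ u, α u ≠ f := by
  by_contra! h
  have := Fintype.card_le_of_surjective α h
  simp at this

theorem recolorCount_cons {V : Type} {ℓ m : ℕ} (α : V → Fin ℓ) (c : Fin (m + 1) → V → Fin ℓ)
    (v : V) : RecolorCount (Fin.cons α c : Fin (m + 2) → V → Fin ℓ) v =
      (if α v ≠ c 0 v then 1 else 0) + RecolorCount c v := by
  unfold RecolorCount
  rw [Finset.card_filter, Finset.card_filter, Fin.sum_univ_succ]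
  rfl

theorem colorTrace_cons {V : Type} {ℓ m : ℕ} (α : V → Fin ℓ) (c : Fin (m + 1) → V → Fin ℓ)
    (v : V) : ColorTrace (Fin.cons α c : Fin (m + 2) → V → Fin ℓ) v =
      if α v = c 0 v then ColorTrace c v else α v :: ColorTrace c v := by
  unfold ColorTrace
  rw [List.ofFn_succ]
  simp only [Fin.cons_zero, Fin.cons_succ]
  rw [List.ofFn_succ]
  simp only [List.destutter_cons', List.destutter'_cons]
  split_ifs <;> simp_all

namespace Recolors

variable {α β γ : Fin 4 → Fin 5} {k k' : Fin 4 → ℕ} {L L' : List (Fin 5)}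

theorem trans (h : Recolors α β k L) (h' : Recolors β γ k' L') :
    Recolors α γ (k + k') (L ++ L') := by
  induction h with
  | refl α => simpa using h'
  | step v x hx _ ih =>
    have := step v x hx (ih h')
    convert this using 1
    · abel
    · split_ifs <;> simp

theorem injective (h : Recolors α β k L) (hα : Function.Injective α) : Function.Injective β := by
  induction h with
  | refl α => exact hα
  | step v x hx _ ih => exact ih (injective_update_of_unused hα v hx)

theorem count_three (h : Recolors α β k L) : k 3 = L.length := by
  induction h with
  | refl α => rfl
  | step v x hx _ ih =>
    by_cases hv : v = 3
    · subst hv; simp [ih]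
    · simp [hv, ih, Ne.symm hv]

theorem getLast?_three (h : Recolors α β k L) : (α 3 :: L).getLast? = some (β 3) := by
  induction h with
  | refl α => rfl
  | step v x hx _ ih =>
    by_cases hv : v = 3
    · subst hv; simpa using ih
    · simpa [hv, Function.update_of_ne (Ne.symm hv)] using ih

theorem comp_perm (h : Recolors α β k L) (σ : Equiv.Perm (Fin 4)) (hσ : σ 3 = 3) :
    Recolors (α ∘ σ) (β ∘ σ) (k ∘ σ) L := by
  induction h with
  | refl α => exact refl _
  | @step α β k L v x hx _ ih =>
    rw [Function.update_comp_equiv] at ih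
    have := step (α := α ∘ σ) (σ.symm v) x (fun u => hx _) ih
    convert this using 1
    · funext u
      simp [Pi.single_apply, Equiv.eq_symm_apply]
    · simp [Equiv.symm_apply_eq, hσ]

theorem exists_transformSeq (h : Recolors α β k L) (hα : Function.Injective α) :
    ∃ (m : ℕ) (c : Fin (m + 1) → Fin 4 → Fin 5),
      IsTransformSeq (⊤ : SimpleGraph (Fin 4)) c α β ∧ (∀ v, RecolorCount c v = k v) ∧
        ColorTrace c (3 : Fin 4) = α 3 :: L := by
  induction h with
  | refl α =>
    refine ⟨0, fun _ => α, ⟨rfl, rfl, fun _ => isProperColoring_top_iff_injective.2 hα,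
      fun i => i.elim0⟩, fun v => by simp [RecolorCount], by simp [ColorTrace]⟩
  | @step α β k L v x hx _ ih =>
    obtain ⟨m, c, ⟨h0, hl, hp, hs⟩, hk, ht⟩ := ih (injective_update_of_unused hα v hx)
    refine ⟨m + 1, Fin.cons α c, ⟨rfl, ?_, ?_, ?_⟩, ?_, ?_⟩
    · rw [← Fin.succ_last, Fin.cons_succ, hl]
    · exact Fin.cases (isProperColoring_top_iff_injective.2 hα) hp
    · refine Fin.cases ?_ hs
      refine ⟨v, ?_, ?_⟩
      · simpa [h0] using hx v
      · intro u hu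
        by_contra hne
        exact hu (by simp [h0, hne])
    · intro u
      rw [recolorCount_cons, hk, h0]
      by_cases hu : u = v
      · subst hu; simp [hx u, add_comm]
      · simp [hu]
    · rw [colorTrace_cons, ht, h0]
      by_cases hv : v = 3
      · subst hv; simp [hx 3]
      · simp [hv, Ne.symm hv]

theorem exists_unuse (hα : Function.Injective α) (y : Fin 5) (hy : α 3 ≠ y) :
    ∃ α' k, Recolors α α' k [] ∧ (∀ u, α' u ≠ y) ∧ (∀ u, α u ≠ y → α' u = α u) ∧
      k 0 + k 1 + k 2 ≤ 1 := by
  by_cases hfree : ∀ u, α u ≠ y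
  · exact ⟨α, 0, refl α, hfree, fun _ _ => rfl, by simp⟩
  push Not at hfree
  obtain ⟨j, rfl⟩ := hfree
  obtain ⟨f, hf⟩ := exists_unused_color α
  have hj : j ≠ 3 := fun h => hy (h ▸ rfl)
  refine ⟨Function.update α j f, 0 + Pi.single j 1, ?_, ?_, ?_, ?_⟩
  · simpa [hj] using step j f hf (refl _)
  · intro u
    by_cases hu : u = j
    · subst hu; simpa using (hf u).symm
    · simpa [hu] using fun h : α u = α j => hu (hα h)
  · intro u hu
    exact Function.update_of_ne (fun h => hu (congrArg α h)) _ _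
  · fin_cases j <;> simp_all

theorem exists_of_order (hα : Function.Injective α) (L : List (Fin 5))
    (hL : List.IsChain (· ≠ ·) (α 3 :: L)) :
    ∃ β k, Recolors α β k L ∧ k 0 + k 1 + k 2 ≤ L.length := by
  induction L generalizing α with
  | nil => exact ⟨α, 0, refl α, by simp⟩
  | cons y L ih =>
    rw [List.isChain_cons_cons] at hL
    obtain ⟨α', k, h, hy, -, hk⟩ := exists_unuse hα y hL.1
    obtain ⟨β, k', h', hk'⟩ := ih (α := Function.update α' 3 y)
      (injective_update_of_unused (h.injective hα) 3 hy) (by simpa using hL.2)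
    refine ⟨β, _, h.trans (step 3 y hy h'), ?_⟩
    simp
    omega

theorem exists_set_color (hα : Function.Injective α) (hβ : Function.Injective β)
    (h3 : α 3 = β 3) (v : Fin 4) (hv : v ≠ 3) :
    ∃ α' k, Recolors α α' k [] ∧ α' v = β v ∧ (∀ u, α u = β u → α' u = β u) ∧
      k 0 ≤ 2 ∧ k 1 ≤ 2 ∧ k 2 ≤ 2 := by
  by_cases h : α v = β v
  · exact ⟨α, 0, refl α, h, fun _ => id, by simp⟩
  obtain ⟨α', k, hr, hy, hsame, hk⟩ := exists_unuse hα (β v)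
    (fun he => hv (hβ (h3.symm.trans he)).symm)
  refine ⟨Function.update α' v (β v), _, by simpa [hv] using hr.trans (step v _ hy (refl _)),
    by simp, ?_, ?_⟩
  · intro u hu
    have huv : u ≠ v := fun e => h (e ▸ hu)
    rw [Function.update_of_ne huv, hsame u (fun e => huv (hβ (hu.symm.trans e))), hu]
  · fin_cases v <;> simp <;> omega

theorem exists_of_eq_three (hα : Function.Injective α) (hβ : Function.Injective β)
    (h3 : α 3 = β 3) :
    ∃ k, Recolors α β k [] ∧ k 0 ≤ 6 ∧ k 1 ≤ 6 ∧ k 2 ≤ 6 := by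
  obtain ⟨α₁, k₁, r₁, e₁, s₁, b₁⟩ := exists_set_color hα hβ h3 0 (by decide)
  have i₁ := r₁.injective hα
  obtain ⟨α₂, k₂, r₂, e₂, s₂, b₂⟩ := exists_set_color i₁ hβ (s₁ _ h3) 1 (by decide)
  have i₂ := r₂.injective i₁
  obtain ⟨α₃, k₃, r₃, e₃, s₃, b₃⟩ := exists_set_color i₂ hβ (s₂ _ (s₁ _ h3)) 2 (by decide)
  have he : α₃ = β := by
    funext u
    fin_cases u
    · exact s₃ _ (s₂ _ e₁)
    · exact s₃ _ e₂
    · exact e₃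
    · exact s₃ _ (s₂ _ (s₁ _ h3))
  subst he
  refine ⟨_, (r₁.trans r₂).trans r₃, ?_⟩
  simp only [Pi.add_apply]
  omega

end Recolors

theorem exists_perm_balancing (a b : Fin 4 → ℕ) (ha : a 0 + a 1 + a 2 ≤ 346)
    (hb : b 0 + b 1 + b 2 ≤ 346) :
    ∃ σ : Equiv.Perm (Fin 4), σ 3 = 3 ∧
      a 0 + b (σ 0) ≤ 600 ∧ a 1 + b (σ 1) ≤ 600 ∧ a 2 + b (σ 2) ≤ 600 := by
  by_cases h0 : a 0 + b 0 ≤ 600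
  · by_cases h1 : a 1 + b 1 ≤ 600
    · by_cases h2 : a 2 + b 2 ≤ 600
      · exact ⟨1, rfl, h0, h1, h2⟩
      · refine ⟨Equiv.swap 0 2, by decide, ?_⟩
        rw [show Equiv.swap (0 : Fin 4) 2 0 = 2 by decide,
          show Equiv.swap (0 : Fin 4) 2 1 = 1 by decide,
          show Equiv.swap (0 : Fin 4) 2 2 = 0 by decide]
        omega
    · refine ⟨Equiv.swap 1 2, by decide, ?_⟩
      rw [show Equiv.swap (1 : Fin 4) 2 0 = 0 by decide,
        show Equiv.swap (1 : Fin 4) 2 1 = 2 by decide,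
        show Equiv.swap (1 : Fin 4) 2 2 = 1 by decide]
      omega
  · refine ⟨Equiv.swap 0 1, by decide, ?_⟩
    rw [show Equiv.swap (0 : Fin 4) 1 0 = 1 by decide,
      show Equiv.swap (0 : Fin 4) 1 1 = 0 by decide,
      show Equiv.swap (0 : Fin 4) 1 2 = 2 by decide]
    omega

theorem k4_prescribed_order_recolor_five_colors
    (q : ℕ) (hq : q ≤ 692)
    (cs : Fin (q + 1) → Fin 5) (hcs : ∀ i : Fin q, cs i.castSucc ≠ cs i.succ)
    (α β : Fin 4 → Fin 5)
    (hα : IsProperColoring (⊤ : SimpleGraph (Fin 4)) α)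
    (hβ : IsProperColoring (⊤ : SimpleGraph (Fin 4)) β)
    (hα4 : α 3 = cs 0) (hβ4 : β 3 = cs (Fin.last q)) :
    ∃ (m : ℕ) (c : Fin (m + 1) → Fin 4 → Fin 5),
      IsTransformSeq (⊤ : SimpleGraph (Fin 4)) c α β ∧
      (∀ v : Fin 4, RecolorCount c v ≤ 692) ∧
      (∀ v : Fin 4, v ≠ 3 → RecolorCount c v ≤ 689) ∧
      ColorTrace c (3 : Fin 4) = List.ofFn cs := by
  rw [isProperColoring_top_iff_injective] at hα hβ
  obtain ⟨L, hL⟩ : ∃ L, List.ofFn cs = α 3 :: L := ⟨_, by rw [List.ofFn_succ, hα4]⟩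
  have hlen : L.length = q := by simpa using (congrArg List.length hL).symm
  have hchain : List.IsChain (· ≠ ·) (α 3 :: L) := by
    rw [← hL, List.isChain_iff_getElem]
    intro i hi
    rw [List.getElem_ofFn, List.getElem_ofFn]
    exact hcs ⟨i, by simpa [-List.ofFn_succ] using hi⟩
  have hlast : (α 3 :: L).getLast? = some (β 3) := by
    rw [← hL, hβ4, List.getLast?_eq_getElem?]
    simp [Fin.last, -List.ofFn_succ]
  have hsplit : L.take 346 ++ L.drop 346 = L := List.take_append_drop 346 L
  rw [← hsplit, ← List.cons_append] at hchain
  obtain ⟨γ, a, ra, ha⟩ := Recolors.exists_of_order hα (L.take 346) hchain.left_of_append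
  have hγ := ra.injective hα
  have hγ3 := ra.getLast?_three
  have hchain' : List.IsChain (· ≠ ·) (γ 3 :: L.drop 346) := by
    rw [List.isChain_append] at hchain
    rw [List.isChain_cons]
    exact ⟨fun y hy => hchain.2.2 _ hγ3 y hy, hchain.2.1⟩
  obtain ⟨δ, b, rb, hb⟩ := Recolors.exists_of_order hγ (L.drop 346) hchain'
  rw [List.length_take] at ha
  rw [List.length_drop] at hb
  obtain ⟨σ, hσ, hab⟩ := exists_perm_balancing a b (by omega) (by omega)
  have hγσ := hγ.comp σ.injective
  have rbσ := rb.comp_perm σ hσ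
  obtain ⟨d, rd, hd⟩ := Recolors.exists_of_eq_three hγ hγσ (by simp [hσ])
  have run := (ra.trans rd).trans rbσ
  rw [List.append_nil, hsplit] at run
  obtain ⟨e, re, he⟩ := Recolors.exists_of_eq_three (run.injective hα) hβ
    (Option.some_injective _ (run.getLast?_three.symm.trans hlast))
  have total := run.trans re
  rw [List.append_nil] at total
  have h3 := total.count_three
  obtain ⟨m, c, hc, hcount, htrace⟩ := total.exists_transformSeq hα
  have hbound : ∀ v : Fin 4, v ≠ 3 → RecolorCount c v ≤ 689 := by
    intro v hv
    rw [hcount]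
    fin_cases v <;> simp at hv ⊢ <;> omega
  refine ⟨m, c, hc, fun v => ?_, hbound, htrace.trans hL.symm⟩
  by_cases hv : v = 3
  · subst hv
    rw [hcount, h3]
    omega
  · exact (hbound v hv).trans (by norm_num)
end
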